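/- arXiv:2011.06516 — 13 statements merged into one kernel-verified Lean document; each statement's English description precedes it below -/
import Mathlib

section
/- Let p ∈ [0,1) and let p = t_0 ≤ t_1 ≤ t_2 ≤ ⋯ ≤ 1 be a nondecreasing sequence with t_1 > 0 and sup_{i≥1} t_i = 1, and let q be the associated threshold function. Then for every ℓ ≥ 1 and every t ∈ [t_ℓ, 1), the feasibility constraint is tight: t·q(t,ℓ) + ∫_p^t ∑_{s≥1} q(τ,s) dτ = 1. -/
open MeasureTheory Classical

/-- The threshold function associated with a nondecreasing sequence `ts` (with `ts 0 = p`):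
`q(t,ℓ) = T_i / t^(i+1)` if `t ∈ [ts i, ts (i+1))` and `1 ≤ ℓ ≤ i`, and `q(t,ℓ) = 0`
otherwise, where `T_i = ∏_{j=1}^i ts j`. -/
noncomputable def thresholdFun (ts : ℕ → ℝ) (t : ℝ) (ℓ : ℕ) : ℝ :=
  if h : ∃ i : ℕ, ts i ≤ t ∧ t < ts (i + 1) ∧ 1 ≤ ℓ ∧ ℓ ≤ i then
    (∏ j ∈ Finset.Icc 1 h.choose, ts j) / t ^ (h.choose + 1)
  else 0

theorem thresholdFun_eq_of_mem {ts : ℕ → ℝ} (hmono : Monotone ts) {t : ℝ} {i : ℕ}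
    (h₁ : ts i ≤ t) (h₂ : t < ts (i + 1)) (ℓ : ℕ) :
    thresholdFun ts t ℓ =
      if 1 ≤ ℓ ∧ ℓ ≤ i then (∏ j ∈ Finset.Icc 1 i, ts j) / t ^ (i + 1) else 0 := by
  have huniq : ∀ k, ts k ≤ t → t < ts (k + 1) → k = i := fun k hk₁ hk₂ => by
    have := hmono.reflect_lt (hk₁.trans_lt h₂)
    have := hmono.reflect_lt (h₁.trans_lt hk₂)
    omega
  unfold thresholdFun
  split_ifs with h hℓ hℓ
  · rw [huniq _ h.choose_spec.1 h.choose_spec.2.1]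
  · have hs := h.choose_spec
    rw [huniq _ hs.1 hs.2.1] at hs
    exact absurd hs.2.2 hℓ
  · exact absurd ⟨i, h₁, h₂, hℓ⟩ h
  · rfl

theorem tsum_thresholdFun_of_mem {ts : ℕ → ℝ} (hmono : Monotone ts) {t : ℝ} {i : ℕ}
    (h₁ : ts i ≤ t) (h₂ : t < ts (i + 1)) :
    ∑' s : ℕ, thresholdFun ts t (s + 1) =
      i * ((∏ j ∈ Finset.Icc 1 i, ts j) / t ^ (i + 1)) := by
  simp only [thresholdFun_eq_of_mem hmono h₁ h₂]
  rw [tsum_eq_sum (s := Finset.range i) fun s hs => if_neg (by simp at hs; omega),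
    Finset.sum_congr rfl fun s hs => if_pos (by simp at hs; omega)]
  simp

/-- On each piece `[ts i, ts (i+1)]` the total threshold mass has antiderivative `-T_i / τ^i`. -/
theorem intervalIntegral_tsum_thresholdFun_piece {ts : ℕ → ℝ} (hmono : Monotone ts)
    (h0 : 0 ≤ ts 0) (hpos : 0 < ts 1) {i : ℕ} {b : ℝ} (hb : ts i ≤ b) (hb' : b ≤ ts (i + 1)) :
    IntervalIntegrable (fun τ => ∑' s : ℕ, thresholdFun ts τ (s + 1)) volume (ts i) b ∧
      ∫ τ in ts i..b, ∑' s : ℕ, thresholdFun ts τ (s + 1) =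
        (∏ j ∈ Finset.Icc 1 i, ts j) / ts i ^ i - (∏ j ∈ Finset.Icc 1 i, ts j) / b ^ i := by
  set T := ∏ j ∈ Finset.Icc 1 i, ts j
  have hnn : ∀ j, 0 ≤ ts j := fun j => h0.trans (hmono j.zero_le)
  have hT : 0 ≤ T := Finset.prod_nonneg fun j _ => hnn j
  have hcont : ContinuousOn (fun τ : ℝ => -(T / τ ^ i)) (Set.Icc (ts i) b) := by
    refine (continuousOn_const.div (continuousOn_id.pow i) fun τ hτ => ?_).neg
    rcases Nat.eq_zero_or_pos i with rfl | hi
    · simp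
    · exact pow_ne_zero _ ((hpos.trans_le (hmono hi)).trans_le hτ.1).ne'
  have hderiv : ∀ τ ∈ Set.Ioo (ts i) b, HasDerivAt (fun τ : ℝ => -(T / τ ^ i))
      (∑' s : ℕ, thresholdFun ts τ (s + 1)) τ := by
    intro τ hτ
    have hτ0 : τ ≠ 0 := ((hnn i).trans_lt hτ.1).ne'
    rw [tsum_thresholdFun_of_mem hmono hτ.1.le (hτ.2.trans_le hb')]
    refine ((hasDerivAt_const τ T).div (hasDerivAt_pow i τ) (pow_ne_zero i hτ0)).neg.congr_deriv ?_
    change _ = (i : ℝ) * (T / τ ^ (i + 1))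
    clear_value T
    rcases i with _ | i
    · simp
    · rw [Nat.add_sub_cancel]
      field_simp
      ring
  have hint : IntervalIntegrable (fun τ => ∑' s : ℕ, thresholdFun ts τ (s + 1))
      volume (ts i) b := by
    rw [intervalIntegrable_iff_integrableOn_Ioc_of_le hb]
    refine intervalIntegral.integrableOn_deriv_of_nonneg hcont hderiv fun τ hτ => ?_
    have hτ0 : 0 ≤ τ := (hnn i).trans hτ.1.le
    rw [tsum_thresholdFun_of_mem hmono hτ.1.le (hτ.2.trans_le hb')]
    positivity
  refine ⟨hint, ?_⟩
  rw [intervalIntegral.integral_eq_sub_of_hasDerivAt_of_le hb hcont hderiv hint]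
  ring

theorem intervalIntegral_tsum_thresholdFun_knot {ts : ℕ → ℝ} (hmono : Monotone ts)
    (h0 : 0 ≤ ts 0) (hpos : 0 < ts 1) (k : ℕ) :
    IntervalIntegrable (fun τ => ∑' s : ℕ, thresholdFun ts τ (s + 1)) volume (ts 0) (ts k) ∧
      ∫ τ in ts 0..ts k, ∑' s : ℕ, thresholdFun ts τ (s + 1) =
        1 - (∏ j ∈ Finset.Icc 1 k, ts j) / ts k ^ k := by
  induction k with
  | zero => simp
  | succ k ih =>
    obtain ⟨hint, heq⟩ := intervalIntegral_tsum_thresholdFun_piece hmono h0 hpos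
      (hmono k.le_succ) le_rfl
    refine ⟨ih.1.trans hint, ?_⟩
    have hk : ts (k + 1) ≠ 0 := (hpos.trans_le (hmono (by omega))).ne'
    rw [← intervalIntegral.integral_add_adjacent_intervals ih.1 hint, ih.2, heq,
      Finset.prod_Icc_succ_top (by omega)]
    field_simp
    ring

theorem stmt1 (p : ℝ) (hp0 : 0 ≤ p) (hp1 : p < 1) (ts : ℕ → ℝ)
    (h0 : ts 0 = p) (hmono : Monotone ts) (hub : ∀ i, ts i ≤ 1)
    (hpos : 0 < ts 1) (hsup : (⨆ i, ts i) = 1) :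
    ∀ ℓ : ℕ, 1 ≤ ℓ → ∀ t : ℝ, ts ℓ ≤ t → t < 1 →
      t * thresholdFun ts t ℓ +
        (∫ τ in p..t, ∑' s : ℕ, thresholdFun ts τ (s + 1)) = 1 := by
  intro ℓ hℓ t ht ht1
  subst h0
  have hex : ∃ n, t < ts n := exists_lt_of_lt_ciSup (hsup ▸ ht1)
  obtain ⟨i, hi⟩ : ∃ i, ts i ≤ t ∧ t < ts (i + 1) := by
    have hne : Nat.find hex ≠ 0 := fun h =>
      absurd (h ▸ Nat.find_spec hex) (((hmono ℓ.zero_le).trans ht).not_gt)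
    obtain ⟨i, hi⟩ := Nat.exists_eq_succ_of_ne_zero hne
    exact ⟨i, not_lt.1 (Nat.find_min hex (by omega)), by simpa [hi] using Nat.find_spec hex⟩
  have hℓi : ℓ ≤ i := Nat.lt_succ_iff.1 (hmono.reflect_lt (ht.trans_lt hi.2))
  have ht0 : t ≠ 0 := ((hpos.trans_le (hmono hℓ)).trans_le ht).ne'
  obtain ⟨hint, heq⟩ := intervalIntegral_tsum_thresholdFun_piece hmono hp0 hpos hi.1 hi.2.le
  obtain ⟨hint', heq'⟩ := intervalIntegral_tsum_thresholdFun_knot hmono hp0 hpos i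
  rw [← intervalIntegral.integral_add_adjacent_intervals hint' hint, heq, heq',
    thresholdFun_eq_of_mem hmono hi.1 hi.2, if_pos ⟨hℓ, hℓi⟩, pow_succ]
  field_simp
  ring
end

section
/- For every integer j ≥ 1, ∫_{1/e}^1 (1−τ)^{j−1}/τ dτ ≥ e^{−(j−1)}, with equality for j = 1 and j = 2. -/
theorem integral_const_mul_inv_sub_const (a b : ℝ) :
    ∫ τ in (Real.exp 1)⁻¹..1, (a * τ⁻¹ - b) = a - b * (1 - (Real.exp 1)⁻¹) := by
  have hpos : 0 < (Real.exp 1)⁻¹ := by positivity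
  have hle : (Real.exp 1)⁻¹ ≤ 1 := inv_le_one_of_one_le₀ (Real.one_le_exp zero_le_one)
  have hint : IntervalIntegrable (fun τ : ℝ => a * τ⁻¹) MeasureTheory.volume
      (Real.exp 1)⁻¹ 1 := by
    refine (intervalIntegral.intervalIntegrable_inv (fun τ hτ => ?_) continuousOn_id).const_mul a
    rw [Set.uIcc_of_le hle] at hτ
    exact (hpos.trans_le hτ.1).ne'
  rw [intervalIntegral.integral_sub hint intervalIntegrable_const,
    intervalIntegral.integral_const_mul, integral_inv_of_pos hpos one_pos]
  simp
  ring

theorem exp_neg_le_integral_one_sub_pow_div (n : ℕ) :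
    Real.exp (-(n : ℝ)) ≤ ∫ τ in (Real.exp 1)⁻¹..1, (1 - τ) ^ n / τ := by
  have hpos : 0 < (Real.exp 1)⁻¹ := by positivity
  have hle : (Real.exp 1)⁻¹ ≤ 1 := inv_le_one_of_one_le₀ (Real.one_le_exp zero_le_one)
  have hne : ∀ τ ∈ Set.uIcc (Real.exp 1)⁻¹ 1, τ ≠ 0 := fun τ hτ => by
    rw [Set.uIcc_of_le hle] at hτ
    exact (hpos.trans_le hτ.1).ne'
  set c := Real.exp (-(n : ℝ)) with hc
  have hcpow : c * Real.exp 1 ^ n = 1 := by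
    rw [hc, ← Real.exp_nat_mul, ← Real.exp_add]
    simp
  have hval : ∫ τ in (Real.exp 1)⁻¹..1,
      (c * (1 + n * (Real.exp 1 - 1)) * τ⁻¹ - c * (n * Real.exp 1)) = c := by
    rw [integral_const_mul_inv_sub_const]
    field_simp
    ring
  rw [← hval]
  refine intervalIntegral.integral_mono_on hle ?_ ?_ fun τ hτ => ?_
  · exact ((continuousOn_const.mul (continuousOn_id.inv₀ hne)).sub
      continuousOn_const).intervalIntegrable
  · exact (((continuousOn_const.sub continuousOn_id).pow n).div continuousOn_id
      hne).intervalIntegrable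
  · have hτ0 : 0 < τ := hpos.trans_le hτ.1
    have hnonneg : 0 ≤ Real.exp 1 * (1 - τ) :=
      mul_nonneg (Real.exp_pos 1).le (sub_nonneg.2 hτ.2)
    have hbern := one_add_mul_le_pow (a := Real.exp 1 * (1 - τ) - 1) (by linarith) n
    rw [add_sub_cancel, mul_pow] at hbern
    have hmul := mul_le_mul_of_nonneg_left hbern (Real.exp_pos (-(n : ℝ))).le
    rw [← hc, ← mul_assoc, hcpow, one_mul] at hmul
    rw [le_div_iff₀ hτ0]
    refine le_of_eq_of_le ?_ hmul
    field_simp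
    ring


theorem stmt6 :
    (∀ j : ℕ, 1 ≤ j →
      Real.exp (-((j : ℝ) - 1)) ≤ ∫ τ in (Real.exp 1)⁻¹..1, (1 - τ) ^ (j - 1) / τ) ∧
    (∫ τ in (Real.exp 1)⁻¹..1, (1 - τ) ^ ((0 : ℕ)) / τ) = Real.exp (-(((1 : ℕ) : ℝ) - 1)) ∧
    (∫ τ in (Real.exp 1)⁻¹..1, (1 - τ) ^ ((1 : ℕ)) / τ) = Real.exp (-(((2 : ℕ) : ℝ) - 1)) := by
  have hle : (Real.exp 1)⁻¹ ≤ 1 := inv_le_one_of_one_le₀ (Real.one_le_exp zero_le_one)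
  refine ⟨fun j hj => ?_, ?_, ?_⟩
  · simpa [Nat.cast_sub hj] using exp_neg_le_integral_one_sub_pow_div (j - 1)
  · simpa using integral_const_mul_inv_sub_const 1 0
  · have h := integral_const_mul_inv_sub_const 1 1
    have hcongr : ∫ τ in (Real.exp 1)⁻¹..1, (1 - τ) ^ (1 : ℕ) / τ =
        ∫ τ in (Real.exp 1)⁻¹..1, (1 * τ⁻¹ - 1) := by
      refine intervalIntegral.integral_congr fun τ hτ => ?_
      rw [Set.uIcc_of_le hle] at hτ
      have hτ0 : τ ≠ 0 := ((inv_pos.2 (Real.exp_pos 1)).trans_le hτ.1).ne'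
      field_simp
    rw [hcongr, h, ← Real.exp_neg]
    norm_num
end

section
/- For every real p with 0 ≤ p ≤ 1/e and every integer k ≥ 1, (1/e) · ∑_{j=1}^k ∫_{1/e}^1 (1−τ)^{j−1}/τ dτ ≥ (1−p^k)/(e(1−p)). Consequently, the threshold sequence t_1 = 1/e, t_i = 1 for i ≥ 2 certifies that the optimal competitive ratio of the p-DOS problem with adversarial values is at least 1/(e(1−p)) for all p ≤ 1/e. -/
open intervalIntegral in
/-- Jensen's inequality for the `n`-th power, under the probability density `1 / τ` on `[1/e, 1]`,
for which `1 - τ` has mean `1/e`. -/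
lemma inv_exp_one_pow_le_integral (n : ℕ) :
    (Real.exp 1)⁻¹ ^ n ≤ ∫ τ in (Real.exp 1)⁻¹..1, (1 - τ) ^ n / τ := by
  have he : 0 < Real.exp 1 := Real.exp_pos 1
  have hq : 0 < (Real.exp 1)⁻¹ := inv_pos.2 he
  have hq1 : (Real.exp 1)⁻¹ ≤ 1 := inv_le_one_of_one_le₀ (Real.one_le_exp zero_le_one)
  have hpos : ∀ τ ∈ Set.uIcc (Real.exp 1)⁻¹ 1, τ ≠ 0 := fun τ hτ => by
    rw [Set.uIcc_of_le hq1] at hτ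
    exact (hq.trans_le hτ.1).ne'
  have hinv : IntervalIntegrable (fun τ : ℝ => τ⁻¹) MeasureTheory.volume (Real.exp 1)⁻¹ 1 :=
    (continuousOn_id.inv₀ hpos).intervalIntegrable
  have hlin : ∫ τ in (Real.exp 1)⁻¹..1,
      (Real.exp 1)⁻¹ ^ n * ((1 + n * (Real.exp 1 - 1)) * τ⁻¹ - n * Real.exp 1) =
        (Real.exp 1)⁻¹ ^ n := by
    rw [integral_const_mul, integral_sub (hinv.const_mul _) intervalIntegrable_const,
      integral_const_mul, integral_inv_of_pos hq one_pos, integral_const]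
    simp only [one_div, inv_inv, Real.log_exp, smul_eq_mul]
    field_simp
    ring
  rw [← hlin]
  refine integral_mono_on hq1 ?_ ?_ fun τ hτ => ?_
  · exact ((hinv.const_mul _).sub intervalIntegrable_const).const_mul _
  · exact (ContinuousOn.div (by fun_prop) continuousOn_id hpos).intervalIntegrable
  · have hτ0 : 0 < τ := hq.trans_le hτ.1
    have hbern := one_add_mul_sub_le_pow (a := Real.exp 1 * (1 - τ))
      (by linarith [mul_nonneg he.le (sub_nonneg.2 hτ.2)]) n
    rw [le_div_iff₀ hτ0]
    calc _ = (Real.exp 1)⁻¹ ^ n * (1 + n * (Real.exp 1 * (1 - τ) - 1)) := by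
          field_simp
          ring
      _ ≤ (Real.exp 1)⁻¹ ^ n * (Real.exp 1 * (1 - τ)) ^ n := by gcongr
      _ = (1 - τ) ^ n := by rw [← mul_pow, inv_mul_cancel_left₀ he.ne']

theorem stmt7 (p : ℝ) (hp0 : 0 ≤ p) (hp : p ≤ (Real.exp 1)⁻¹) (k : ℕ) (hk : 1 ≤ k) :
    (1 - p ^ k) / (Real.exp 1 * (1 - p)) ≤
      (Real.exp 1)⁻¹ *
        ∑ j ∈ Finset.Icc 1 k, ∫ τ in (Real.exp 1)⁻¹..1, (1 - τ) ^ (j - 1) / τ := by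
  have hp1 : p < 1 := hp.trans_lt (inv_lt_one_of_one_lt₀ (Real.one_lt_exp_iff.2 one_pos))
  have hgeom : ∑ j ∈ Finset.Icc 1 k, p ^ (j - 1) = (1 - p ^ k) / (1 - p) := by
    rw [← Finset.Ico_add_one_right_eq_Icc, Finset.sum_Ico_eq_sum_range,
      eq_div_iff (sub_pos.2 hp1).ne', ← geom_sum_mul_neg]
    simp
  calc (1 - p ^ k) / (Real.exp 1 * (1 - p))
      = (Real.exp 1)⁻¹ * ∑ j ∈ Finset.Icc 1 k, p ^ (j - 1) := by
        rw [hgeom, div_mul_eq_div_div_swap, div_eq_inv_mul _ (Real.exp 1)]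
    _ ≤ _ := by
        gcongr with j
        exact (pow_le_pow_left₀ hp0 hp _).trans (inv_exp_one_pow_le_integral _)
end

section
/- Let p ∈ [0,1) and let q : [p,1] × ℕ₊ → ℝ be a nonnegative integrable function such that for every t ∈ [p,1] the map ℓ ↦ q(t,ℓ) is nonincreasing. Then inf_{k≥1} (1/(1−p^k)) ∑_{j=1}^k ∫_p^1 ∑_{ℓ=1}^j q(t,ℓ) C(j−1,ℓ−1)(1−t)^{j−ℓ} t^ℓ dt ≥ inf_{k≥1} (1/(1−p^k)) ∑_{j=1}^k ∫_p^1 t·q(t,j) dt. -/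
open MeasureTheory

/-- The shifted binomial weights sum to `t`. -/
theorem sum_shifted_binomial_weights (t : ℝ) {j : ℕ} (hj : 1 ≤ j) :
    ∑ ℓ ∈ Finset.Icc 1 j, (Nat.choose (j - 1) (ℓ - 1) : ℝ) * (1 - t) ^ (j - ℓ) * t ^ ℓ = t := by
  obtain ⟨n, rfl⟩ := Nat.exists_eq_add_of_le' hj
  have hbin := add_pow t (1 - t) n
  rw [add_sub_cancel, one_pow] at hbin
  rw [← Finset.Ico_add_one_right_eq_Icc, Finset.sum_Ico_eq_sum_range, Nat.add_sub_cancel]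
  calc _ = t * ∑ m ∈ Finset.range (n + 1), t ^ m * (1 - t) ^ (n - m) * (n.choose m : ℝ) := by
        rw [Finset.mul_sum]
        refine Finset.sum_congr rfl fun m _ => ?_
        rw [show n + 1 - (1 + m) = n - m by omega, Nat.add_sub_cancel_left, Nat.add_sub_cancel]
        ring
    _ = t := by rw [← hbin, mul_one]

/-- A nonincreasing sequence averaged against shifted binomial weights on `{1, …, j}` is at least
its last value. -/
theorem mul_le_sum_shifted_binomial {t : ℝ} (ht0 : 0 ≤ t) (ht1 : t ≤ 1) {a : ℕ → ℝ}
    (ha : ∀ ℓ, 1 ≤ ℓ → a (ℓ + 1) ≤ a ℓ) {j : ℕ} (hj : 1 ≤ j) :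
    t * a j ≤ ∑ ℓ ∈ Finset.Icc 1 j,
      a ℓ * (Nat.choose (j - 1) (ℓ - 1) : ℝ) * (1 - t) ^ (j - ℓ) * t ^ ℓ := by
  have anti : ∀ ℓ, 1 ≤ ℓ → ∀ m, ℓ ≤ m → a m ≤ a ℓ := by
    intro ℓ hℓ m hm
    induction m, hm using Nat.le_induction with
    | base => exact le_rfl
    | succ m hm ih => exact (ha m (hℓ.trans hm)).trans ih
  have ht : 0 ≤ 1 - t := sub_nonneg.2 ht1
  conv_lhs => rw [← sum_shifted_binomial_weights t hj, Finset.sum_mul]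
  refine Finset.sum_le_sum fun ℓ hℓ => ?_
  obtain ⟨h1, h2⟩ := Finset.mem_Icc.1 hℓ
  calc _ ≤ (Nat.choose (j - 1) (ℓ - 1) : ℝ) * (1 - t) ^ (j - ℓ) * t ^ ℓ * a ℓ :=
        mul_le_mul_of_nonneg_left (anti ℓ h1 j h2) (by positivity)
    _ = _ := by ring

theorem stmt8 (p : ℝ) (hp0 : 0 ≤ p) (hp1 : p < 1) (q : ℝ → ℕ → ℝ)
    (hq_nonneg : ∀ t ∈ Set.Icc p 1, ∀ ℓ : ℕ, 1 ≤ ℓ → 0 ≤ q t ℓ)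
    (hq_int : ∀ ℓ, IntervalIntegrable (fun t => q t ℓ) volume p 1)
    (hq_mono : ∀ t ∈ Set.Icc p 1, ∀ ℓ : ℕ, 1 ≤ ℓ → q t (ℓ + 1) ≤ q t ℓ) :
    (⨅ k : ℕ+, (1 / (1 - p ^ (k : ℕ))) *
        ∑ j ∈ Finset.Icc 1 (k : ℕ), ∫ t in p..1, t * q t j)
      ≤ ⨅ k : ℕ+, (1 / (1 - p ^ (k : ℕ))) *
          ∑ j ∈ Finset.Icc 1 (k : ℕ), ∫ t in p..1,
            ∑ ℓ ∈ Finset.Icc 1 j, q t ℓ * (Nat.choose (j - 1) (ℓ - 1) : ℝ) *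
              (1 - t) ^ (j - ℓ) * t ^ ℓ := by
  have hfactor : ∀ k : ℕ+, 0 ≤ 1 / (1 - p ^ (k : ℕ)) := fun k =>
    one_div_nonneg.2 (sub_nonneg.2 (pow_le_one₀ hp0 hp1.le))
  refine ciInf_mono ⟨0, ?_⟩ fun k => ?_
  · rintro _ ⟨k, rfl⟩
    refine mul_nonneg (hfactor k) (Finset.sum_nonneg fun j hj => ?_)
    exact intervalIntegral.integral_nonneg hp1.le fun t ht =>
      mul_nonneg (hp0.trans ht.1) (hq_nonneg t ht j (Finset.mem_Icc.1 hj).1)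
  · refine mul_le_mul_of_nonneg_left (Finset.sum_le_sum fun j hj => ?_) (hfactor k)
    refine intervalIntegral.integral_mono_on hp1.le ?_ ?_ fun t ht =>
      mul_le_sum_shifted_binomial (hp0.trans ht.1) ht.2 (hq_mono t ht) (Finset.mem_Icc.1 hj).1
    · exact (hq_int j).continuousOn_mul continuousOn_id
    · have hsum := IntervalIntegrable.sum (Finset.Icc 1 j) fun ℓ _ =>
        (((hq_int ℓ).mul_const (Nat.choose (j - 1) (ℓ - 1) : ℝ)).mul_continuousOn
          (g := fun t => (1 - t) ^ (j - ℓ)) (by fun_prop)).mul_continuousOn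
          (g := fun t => t ^ ℓ) (by fun_prop)
      simpa only [Finset.sum_fn] using hsum
end

section
/- Let p ∈ (0,1) and let p = t_1 ≤ t_2 ≤ ⋯ ≤ 1 be a nondecreasing sequence with sup_{i≥1} t_i = 1, let q be the associated threshold function (with t_0 := p), and set μ_k := ∑_{i=k}^∞ T_i/(t_i^{i−1} (i−2)(i−1)) for k ≥ 3. Then ∫_p^1 t·q(t,1) dt = p·ln(t_2/p) + p − μ_3, and for every k ≥ 2, ∫_p^1 t·q(t,k) dt = (1/(k−1)) · T_k/t_k^{k−1} − μ_{k+1}. In particular, the system of equations α(1−p^k) = ∑_{j=1}^k ∫_p^1 t·q(t,j) dt for all k ≥ 1 is equivalent to α(1−p) = p·ln(t_2/p) + p − μ_3 together with α(1−p)p^{k−1} = (1/(k−1))·T_k/t_k^{k−1} − μ_{k+1} for all k ≥ 2. -/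
open MeasureTheory Classical

/-- `T_i = ∏_{j=1}^i ts j`. -/
noncomputable def Tprod (ts : ℕ → ℝ) (i : ℕ) : ℝ := ∏ j ∈ Finset.Icc 1 i, ts j

/-- `μ_k = ∑_{i=k}^∞ T_i / (ts i ^ (i-1) * (i-2) * (i-1))`. -/
noncomputable def muSeq (ts : ℕ → ℝ) (k : ℕ) : ℝ :=
  ∑' i : ℕ, if k ≤ i then
    Tprod ts i / ((ts i) ^ (i - 1) * ((i : ℝ) - 2) * ((i : ℝ) - 1)) else 0

namespace ThresholdFun

open Filter Topology

variable {ts : ℕ → ℝ}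

lemma Tprod_succ (ts : ℕ → ℝ) (i : ℕ) : Tprod ts (i + 1) = Tprod ts i * ts (i + 1) :=
  Finset.prod_Icc_succ_top (by omega) _

lemma Tprod_pos (hpos : ∀ i, 0 < ts i) (i : ℕ) : 0 < Tprod ts i :=
  Finset.prod_pos fun j _ => hpos j

lemma Tprod_le_pow (hpos : ∀ i, 0 < ts i) (hmono : Monotone ts) (i : ℕ) :
    Tprod ts i ≤ ts i ^ i := by
  calc Tprod ts i ≤ ∏ _j ∈ Finset.Icc 1 i, ts i :=
        Finset.prod_le_prod (fun j _ => (hpos j).le)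
          fun j hj => hmono (Finset.mem_Icc.1 hj).2
    _ = ts i ^ i := by simp

/-- The normalized product `T_i / t_i^(i-1)`. -/
noncomputable def ratio (ts : ℕ → ℝ) (i : ℕ) : ℝ := Tprod ts i / ts i ^ (i - 1)

lemma ratio_pos (hpos : ∀ i, 0 < ts i) (i : ℕ) : 0 < ratio ts i :=
  div_pos (Tprod_pos hpos i) (pow_pos (hpos i) _)

lemma ratio_le_one (hpos : ∀ i, 0 < ts i) (hmono : Monotone ts) (hub : ∀ i, ts i ≤ 1) (i : ℕ) :
    ratio ts i ≤ 1 :=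
  div_le_one_of_le₀ ((Tprod_le_pow hpos hmono i).trans
    (pow_le_pow_of_le_one (hpos i).le (hub i) (Nat.sub_le i 1))) (pow_pos (hpos i) _).le

lemma ratio_succ (hpos : ∀ i, 0 < ts i) {i : ℕ} (hi : 1 ≤ i) :
    ratio ts (i + 1) = Tprod ts i / ts (i + 1) ^ (i - 1) := by
  obtain ⟨j, rfl⟩ := Nat.exists_eq_add_of_le' hi
  have := (hpos (j + 1 + 1)).ne'
  rw [ratio, Tprod_succ]
  simp only [Nat.add_sub_cancel]
  field_simp
  ring

/-- On `[t_i, t_{i+1})` the index in the definition of the threshold function is `i`. -/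
lemma thresholdFun_eq (hmono : Monotone ts) {t : ℝ} {i : ℕ} (hi : ts i ≤ t)
    (hi' : t < ts (i + 1)) {k : ℕ} (hk : 1 ≤ k) :
    thresholdFun ts t k = if k ≤ i then Tprod ts i / t ^ (i + 1) else 0 := by
  have huniq : ∀ j, ts j ≤ t → t < ts (j + 1) → j = i := by
    intro j hj hj'
    rcases lt_trichotomy j i with h | h | h
    · exact absurd (hmono (show j + 1 ≤ i from h)) (not_le.2 (hi.trans_lt hj'))
    · exact h
    · exact absurd (hmono (show i + 1 ≤ j from h)) (not_le.2 (hj.trans_lt hi'))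
  unfold thresholdFun
  by_cases hki : k ≤ i
  · have h : ∃ i : ℕ, ts i ≤ t ∧ t < ts (i + 1) ∧ 1 ≤ k ∧ k ≤ i := ⟨i, hi, hi', hk, hki⟩
    rw [dif_pos h, if_pos hki, huniq _ h.choose_spec.1 h.choose_spec.2.1, Tprod]
  · rw [if_neg hki, dif_neg]
    rintro ⟨j, hj, hj', -, hkj⟩
    exact hki (huniq j hj hj' ▸ hkj)

lemma mul_thresholdFun_eq (hpos : ∀ i, 0 < ts i) (hmono : Monotone ts) {t : ℝ} {i : ℕ}
    (ht : t ∈ Set.Ico (ts i) (ts (i + 1))) {k : ℕ} (hk : 1 ≤ k) :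
    t * thresholdFun ts t k = if k ≤ i then Tprod ts i * (t ^ i)⁻¹ else 0 := by
  have ht0 : t ≠ 0 := ((hpos i).trans_le ht.1).ne'
  rw [thresholdFun_eq hmono ht.1 ht.2 hk]
  split_ifs
  · field_simp
    ring
  · simp

lemma continuousOn_piece (hpos : ∀ i, 0 < ts i) (i : ℕ) :
    ContinuousOn (fun t : ℝ => Tprod ts i * (t ^ i)⁻¹) (Set.Icc (ts i) (ts (i + 1))) :=
  continuousOn_const.mul ((continuousOn_id.pow i).inv₀
    fun _ ht => pow_ne_zero _ ((hpos i).trans_le ht.1).ne')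

lemma integrableOn_piece (hpos : ∀ i, 0 < ts i) (hmono : Monotone ts) {k : ℕ} (hk : 1 ≤ k)
    (i : ℕ) : IntegrableOn (fun t => t * thresholdFun ts t k) (Set.Ico (ts i) (ts (i + 1))) := by
  refine IntegrableOn.congr_fun (f := fun t => if k ≤ i then Tprod ts i * (t ^ i)⁻¹ else 0) ?_
    (fun t ht => (mul_thresholdFun_eq hpos hmono ht hk).symm) measurableSet_Ico
  split_ifs
  · exact (continuousOn_piece hpos i).integrableOn_Icc.mono_set Set.Ico_subset_Icc_self
  · exact integrableOn_zero

/-- The contribution of `[t_i, t_{i+1})` to the integral of `t * q(t,k)`. -/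
noncomputable def piece (ts : ℕ → ℝ) (k i : ℕ) : ℝ :=
  ∫ t in Set.Ico (ts i) (ts (i + 1)), t * thresholdFun ts t k

lemma piece_eq (hpos : ∀ i, 0 < ts i) (hmono : Monotone ts) {k : ℕ} (hk : 1 ≤ k) (i : ℕ) :
    piece ts k i = if k ≤ i then ∫ t in ts i..ts (i + 1), Tprod ts i * (t ^ i)⁻¹ else 0 := by
  rw [piece, setIntegral_congr_fun measurableSet_Ico
    (fun t ht => mul_thresholdFun_eq hpos hmono ht hk)]
  split_ifs
  · rw [integral_Ico_eq_integral_Ioc, intervalIntegral.integral_of_le (hmono i.le_succ)]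
  · simp

lemma mul_thresholdFun_nonneg (hpos : ∀ i, 0 < ts i) (hmono : Monotone ts) {t : ℝ} {i : ℕ}
    (ht : t ∈ Set.Ico (ts i) (ts (i + 1))) {k : ℕ} (hk : 1 ≤ k) :
    0 ≤ t * thresholdFun ts t k := by
  have ht0 : 0 < t := (hpos i).trans_le ht.1
  rw [mul_thresholdFun_eq hpos hmono ht hk]
  have := Tprod_pos hpos i
  split_ifs <;> positivity

lemma piece_nonneg (hpos : ∀ i, 0 < ts i) (hmono : Monotone ts) {k : ℕ} (hk : 1 ≤ k) (i : ℕ) :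
    0 ≤ piece ts k i :=
  setIntegral_nonneg measurableSet_Ico fun _ ht => mul_thresholdFun_nonneg hpos hmono ht hk

lemma piece_eq_sub (hpos : ∀ i, 0 < ts i) (hmono : Monotone ts) {k i : ℕ} (hk : 1 ≤ k)
    (hki : k ≤ i) (hi : 2 ≤ i) :
    piece ts k i = (ratio ts i - ratio ts (i + 1)) / ((i : ℝ) - 1) := by
  have hmem : (0 : ℝ) ∉ Set.uIcc (ts i) (ts (i + 1)) := by
    rw [Set.uIcc_of_le (hmono i.le_succ)]
    exact fun h => (hpos i).not_ge h.1
  rw [piece_eq hpos hmono hk, if_pos hki, intervalIntegral.integral_const_mul,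
    ratio_succ hpos (by omega), ratio]
  obtain ⟨j, rfl⟩ := Nat.exists_eq_add_of_le' hi
  have hz := integral_zpow (a := ts (j + 2)) (b := ts (j + 2 + 1)) (n := -((j + 2 : ℕ) : ℤ))
    (Or.inr ⟨by omega, hmem⟩)
  have he : (-((j + 2 : ℕ) : ℤ)) + 1 = -((j + 1 : ℕ) : ℤ) := by push_cast; ring
  rw [he] at hz
  simp only [zpow_neg, zpow_natCast] at hz
  rw [hz]
  have h1 : ((j : ℝ) + 1) ≠ 0 := by positivity
  have h2 : (-(j + 2 : ℝ) + 1) = -((j : ℝ) + 1) := by ring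
  have h3 : ((j : ℝ) + 2 - 1) = (j : ℝ) + 1 := by ring
  have ha := (hpos (j + 2)).ne'
  have hb := (hpos (j + 2 + 1)).ne'
  push_cast
  rw [h2, h3]
  field_simp
  ring

lemma piece_one_one (hpos : ∀ i, 0 < ts i) (hmono : Monotone ts) :
    piece ts 1 1 = ts 1 * Real.log (ts 2 / ts 1) := by
  rw [piece_eq hpos hmono le_rfl, if_pos le_rfl, intervalIntegral.integral_const_mul]
  simp [Tprod, integral_inv_of_pos (hpos 1) (hpos 2)]

lemma piece_one (hpos : ∀ i, 0 < ts i) (hmono : Monotone ts) (i : ℕ) :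
    piece ts 1 i = (if i = 1 then ts 1 * Real.log (ts 2 / ts 1) else 0) + piece ts 2 i := by
  split_ifs with h
  · subst h
    rw [piece_one_one hpos hmono, piece_eq hpos hmono one_le_two]
    simp
  · rw [piece_eq hpos hmono le_rfl, piece_eq hpos hmono one_le_two, zero_add]
    have : 1 ≤ i ↔ i = 1 ∨ 2 ≤ i := by omega
    simp [this, h]

/-- The general term of the series `muSeq ts k`. -/
noncomputable def muTerm (ts : ℕ → ℝ) (k i : ℕ) : ℝ :=
  if k ≤ i then Tprod ts i / ((ts i) ^ (i - 1) * ((i : ℝ) - 2) * ((i : ℝ) - 1)) else 0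

lemma muTerm_nonneg (hpos : ∀ i, 0 < ts i) {k : ℕ} (hk : 3 ≤ k) (i : ℕ) :
    0 ≤ muTerm ts k i := by
  unfold muTerm
  split_ifs with h
  · have hi : (3 : ℝ) ≤ i := by exact_mod_cast hk.trans h
    exact div_nonneg (Tprod_pos hpos i).le
      (mul_nonneg (mul_nonneg (pow_pos (hpos i) _).le (by linarith)) (by linarith))
  · exact le_rfl

/-- Summation by parts for the partial sums. -/
lemma sum_piece_add_sum_muTerm (hpos : ∀ i, 0 < ts i) (hmono : Monotone ts) {k : ℕ} (hk : 2 ≤ k)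
    (n : ℕ) :
    ∑ i ∈ Finset.range (k + 1 + n), piece ts k i +
      ∑ i ∈ Finset.range (k + 1 + n), muTerm ts (k + 1) i =
      ratio ts k / ((k : ℝ) - 1) - ratio ts (k + 1 + n) / ((k : ℝ) - 1 + n) := by
  have hk' : (2 : ℝ) ≤ k := by exact_mod_cast hk
  induction n with
  | zero =>
    have h1 : ∑ i ∈ Finset.range k, piece ts k i = 0 := Finset.sum_eq_zero fun i hi => by
      rw [piece_eq hpos hmono (by omega), if_neg (by simpa using hi)]
    have h2 : ∑ i ∈ Finset.range (k + 1), muTerm ts (k + 1) i = 0 :=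
      Finset.sum_eq_zero fun i hi => if_neg (by simpa using hi)
    rw [Nat.add_zero, h2, Finset.sum_range_succ, h1,
      piece_eq_sub hpos hmono (by omega) le_rfl hk]
    push_cast
    ring
  | succ n ih =>
    rw [← add_assoc, Finset.sum_range_succ, Finset.sum_range_succ,
      piece_eq_sub hpos hmono (by omega) (by omega) (by omega)]
    have hm : muTerm ts (k + 1) (k + 1 + n) =
        ratio ts (k + 1 + n) / (((k : ℝ) - 1 + n) * ((k : ℝ) + n)) := by
      rw [muTerm, if_pos (by omega), ratio, div_div]
      push_cast
      ring_nf
    have hn : (0 : ℝ) ≤ n := n.cast_nonneg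
    have h1 : (k : ℝ) - 1 + n ≠ 0 := by linarith
    have h2 : (k : ℝ) + n ≠ 0 := by linarith
    rw [hm, add_add_add_comm, ih]
    push_cast
    rw [show (k : ℝ) + 1 + n - 1 = k + n by ring, show (k : ℝ) - 1 + (n + 1) = k + n by ring]
    field_simp
    ring

lemma summable_muTerm (hpos : ∀ i, 0 < ts i) (hmono : Monotone ts) {k : ℕ} (hk : 2 ≤ k) :
    Summable (muTerm ts (k + 1)) := by
  have hk' : (2 : ℝ) ≤ k := by exact_mod_cast hk
  have hmu := muTerm_nonneg hpos (show 3 ≤ k + 1 by omega)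
  refine summable_of_sum_range_le (c := ratio ts k / ((k : ℝ) - 1)) hmu fun n => ?_
  have h := sum_piece_add_sum_muTerm hpos hmono hk n
  have h1 : 0 ≤ ∑ i ∈ Finset.range (k + 1 + n), piece ts k i :=
    Finset.sum_nonneg fun i _ => piece_nonneg hpos hmono (by omega) i
  have h2 : ∑ i ∈ Finset.range n, muTerm ts (k + 1) i ≤
      ∑ i ∈ Finset.range (k + 1 + n), muTerm ts (k + 1) i :=
    Finset.sum_le_sum_of_subset_of_nonneg (Finset.range_mono (by omega)) fun i _ _ => hmu i
  have h3 : 0 ≤ ratio ts (k + 1 + n) / ((k : ℝ) - 1 + n) :=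
    div_nonneg (ratio_pos hpos _).le (by linarith [n.cast_nonneg (α := ℝ)])
  linarith

lemma tendsto_ratio_div (hpos : ∀ i, 0 < ts i) (hmono : Monotone ts) (hub : ∀ i, ts i ≤ 1)
    {k : ℕ} (hk : 2 ≤ k) :
    Tendsto (fun n : ℕ => ratio ts (k + 1 + n) / ((k : ℝ) - 1 + n)) atTop (𝓝 0) := by
  have hk' : (2 : ℝ) ≤ k := by exact_mod_cast hk
  refine squeeze_zero (fun n => div_nonneg (ratio_pos hpos _).le
    (by linarith [n.cast_nonneg (α := ℝ)])) (fun n => ?_) tendsto_one_div_add_atTop_nhds_zero_nat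
  exact div_le_div₀ zero_le_one (ratio_le_one hpos hmono hub _) (by positivity) (by linarith)

lemma hasSum_piece (hpos : ∀ i, 0 < ts i) (hmono : Monotone ts) (hub : ∀ i, ts i ≤ 1)
    {k : ℕ} (hk : 2 ≤ k) :
    HasSum (piece ts k) (ratio ts k / ((k : ℝ) - 1) - muSeq ts (k + 1)) := by
  rw [hasSum_iff_tendsto_nat_of_nonneg (piece_nonneg hpos hmono (by omega)),
    ← tendsto_add_atTop_iff_nat (k + 1)]
  have hmu := (summable_muTerm hpos hmono hk).hasSum.tendsto_sum_nat.comp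
    (tendsto_add_atTop_nat (k + 1))
  have h := (tendsto_const_nhds (x := ratio ts k / ((k : ℝ) - 1))).sub
    (tendsto_ratio_div hpos hmono hub hk) |>.sub hmu
  rw [sub_zero] at h
  refine h.congr fun n => ?_
  have := sum_piece_add_sum_muTerm hpos hmono hk n
  simp only [Function.comp_apply, add_comm n (k + 1)]
  linarith

lemma hasSum_piece_one (hpos : ∀ i, 0 < ts i) (hmono : Monotone ts) (hub : ∀ i, ts i ≤ 1) :
    HasSum (piece ts 1) (ts 1 * Real.log (ts 2 / ts 1) + (ts 1 - muSeq ts 3)) := by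
  have h := (hasSum_ite_eq 1 (ts 1 * Real.log (ts 2 / ts 1))).add
    (hasSum_piece hpos hmono hub le_rfl)
  have hr : ratio ts 2 / (((2 : ℕ) : ℝ) - 1) = ts 1 := by
    rw [ratio_succ hpos le_rfl]
    norm_num [Tprod]
  rw [hr] at h
  exact (funext (piece_one hpos hmono)) ▸ h

lemma iUnion_Ico_eq (hmono : Monotone ts) (hub : ∀ i, ts i ≤ 1) (hsup : (⨆ i, ts i) = 1) :
    ⋃ i, Set.Ico (ts i) (ts (i + 1)) = Set.Ico (ts 0) 1 := by
  ext t
  simp only [Set.mem_iUnion, Set.mem_Ico]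
  constructor
  · rintro ⟨i, hi, hi'⟩
    exact ⟨(hmono i.zero_le).trans hi, hi'.trans_le (hub _)⟩
  · rintro ⟨h0, h1⟩
    have hex : ∃ n, t < ts n := exists_lt_of_lt_ciSup (hsup ▸ h1)
    have hne : Nat.find hex ≠ 0 := fun h => (Nat.find_spec hex).not_ge (h ▸ h0)
    obtain ⟨j, hj⟩ := Nat.exists_eq_succ_of_ne_zero hne
    exact ⟨j, not_lt.1 (Nat.find_min hex (by omega)), (congrArg (t < ts ·) hj).mp (Nat.find_spec hex)⟩

lemma integral_eq_of_hasSum_piece (hpos : ∀ i, 0 < ts i) (hmono : Monotone ts)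
    (hub : ∀ i, ts i ≤ 1) (hsup : (⨆ i, ts i) = 1) {k : ℕ} (hk : 1 ≤ k) {s : ℝ}
    (hs : HasSum (piece ts k) s) : ∫ t in ts 0..1, t * thresholdFun ts t k = s := by
  have hint : IntegrableOn (fun t => t * thresholdFun ts t k)
      (⋃ i, Set.Ico (ts i) (ts (i + 1))) := by
    refine integrableOn_iUnion_of_summable_integral_norm (integrableOn_piece hpos hmono hk) ?_
    refine hs.summable.congr fun i => (setIntegral_congr_fun measurableSet_Ico fun t ht => ?_)
    exact (Real.norm_of_nonneg (mul_thresholdFun_nonneg hpos hmono ht hk)).symm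
  have h : HasSum (piece ts k) _ := hasSum_integral_iUnion (fun i => measurableSet_Ico)
    (by simpa using hmono.pairwise_disjoint_on_Ico_succ) hint
  rw [iUnion_Ico_eq hmono hub hsup, integral_Ico_eq_integral_Ioc,
    ← intervalIntegral.integral_of_le (hub 0)] at h
  exact h.unique hs

end ThresholdFun

/-- Prescribing all partial sums of a sequence is the same as prescribing its increments. -/
lemma forall_geom_eq_sum_iff (α p : ℝ) (I : ℕ → ℝ) :
    (∀ k : ℕ, 1 ≤ k → α * (1 - p ^ k) = ∑ j ∈ Finset.Icc 1 k, I j) ↔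
      ∀ k : ℕ, 1 ≤ k → α * (1 - p) * p ^ (k - 1) = I k := by
  constructor
  · intro h k hk
    obtain ⟨j, rfl⟩ := Nat.exists_eq_add_of_le' hk
    have h1 := h (j + 1) hk
    rw [Finset.sum_Icc_succ_top (by omega)] at h1
    have h2 : α * (1 - p ^ j) = ∑ j ∈ Finset.Icc 1 j, I j := by
      rcases Nat.eq_zero_or_pos j with rfl | hj
      · simp
      · exact h j hj
    rw [← h2] at h1
    rw [Nat.add_sub_cancel]
    linear_combination h1
  · intro h k _
    induction k with
    | zero => simp
    | succ j ih =>
      have ih' : α * (1 - p ^ j) = ∑ j ∈ Finset.Icc 1 j, I j := by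
        rcases Nat.eq_zero_or_pos j with rfl | hj
        · simp
        · exact ih hj
      have h1 := h (j + 1) (by omega)
      rw [Finset.sum_Icc_succ_top (by omega), ← ih', ← h1, Nat.add_sub_cancel]
      ring

theorem stmt9 (p : ℝ) (hp0 : 0 < p) (hp1 : p < 1) (ts : ℕ → ℝ)
    (h0 : ts 0 = p) (h1 : ts 1 = p) (hmono : Monotone ts) (hub : ∀ i, ts i ≤ 1)
    (hsup : (⨆ i, ts i) = 1) :
    ((∫ t in p..1, t * thresholdFun ts t 1) = p * Real.log (ts 2 / p) + p - muSeq ts 3) ∧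
    (∀ k : ℕ, 2 ≤ k →
      (∫ t in p..1, t * thresholdFun ts t k) =
        (1 / ((k : ℝ) - 1)) * Tprod ts k / (ts k) ^ (k - 1) - muSeq ts (k + 1)) ∧
    (∀ α : ℝ,
      (∀ k : ℕ, 1 ≤ k → α * (1 - p ^ k) =
          ∑ j ∈ Finset.Icc 1 k, ∫ t in p..1, t * thresholdFun ts t j) ↔
        (α * (1 - p) = p * Real.log (ts 2 / p) + p - muSeq ts 3 ∧
         ∀ k : ℕ, 2 ≤ k → α * (1 - p) * p ^ (k - 1) =
           (1 / ((k : ℝ) - 1)) * Tprod ts k / (ts k) ^ (k - 1) - muSeq ts (k + 1))) := by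
  have hpos : ∀ i, 0 < ts i := fun i => hp0.trans_le (h0 ▸ hmono i.zero_le)
  have hI1 : (∫ t in p..1, t * thresholdFun ts t 1) =
      p * Real.log (ts 2 / p) + p - muSeq ts 3 := by
    have h := ThresholdFun.integral_eq_of_hasSum_piece hpos hmono hub hsup le_rfl
      (ThresholdFun.hasSum_piece_one hpos hmono hub)
    rw [h0, h1] at h
    rw [h, add_sub_assoc]
  have hI : ∀ k : ℕ, 2 ≤ k → (∫ t in p..1, t * thresholdFun ts t k) =
      (1 / ((k : ℝ) - 1)) * Tprod ts k / (ts k) ^ (k - 1) - muSeq ts (k + 1) := by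
    intro k hk
    have h := ThresholdFun.integral_eq_of_hasSum_piece hpos hmono hub hsup (by omega)
      (ThresholdFun.hasSum_piece hpos hmono hub hk)
    rw [h0] at h
    rw [h, ThresholdFun.ratio]
    ring
  refine ⟨hI1, hI, fun α => ?_⟩
  rw [forall_geom_eq_sum_iff α p fun j => ∫ t in p..1, t * thresholdFun ts t j]
  constructor
  · intro h
    refine ⟨?_, fun k hk => (h k (by omega)).trans (hI k hk)⟩
    simpa [hI1] using h 1 le_rfl
  · rintro ⟨ha, hb⟩ k hk
    rcases hk.eq_or_lt with rfl | hk
    · simpa [hI1] using ha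
    · exact (hb k hk).trans (hI k hk).symm
end

section
/- Let p, α ∈ (0,1) and set γ_k := 1 − α + α(k p^{k−1} − (k−1)p^k) for k ≥ 1 (so γ_1 = 1 and γ_k > 0 for all k). Define t_1 := p, t_2 := p·exp(α(1−p)²/p), and for k ≥ 2 let t_{k+1} be the unique positive real with (t_k/t_{k+1})^{k−1} = γ_k/γ_{k−1}. Then: (i) the sequence (t_k)_{k≥1} is nondecreasing; (ii) lim_{k→∞} t_k ≤ 1 if and only if ln p + α(1−p)²/p ≤ ∑_{i=1}^∞ ln(γ_{i+1})/(i(i+1)), with lim_{k→∞} t_k = 1 exactly when equality holds; (iii) for every i ≥ 2, T_i/t_i^{i−1} = p·γ_{i−1}, where T_i := ∏_{j=1}^i t_j. -/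
open Filter Topology

/-- The sequence `γ (n + 1) = 1 - α + α ((n + 1) p ^ n - n p ^ (n + 1))`. -/
noncomputable def binomWeight (p α : ℝ) (n : ℕ) : ℝ :=
  1 - α + α * (((n : ℝ) + 1) * p ^ n - n * p ^ (n + 1))

section binomWeight

variable {p α : ℝ}

lemma binomWeight_zero (p α : ℝ) : binomWeight p α 0 = 1 := by
  simp [binomWeight]

lemma binomWeight_lower_bound (hp0 : 0 < p) (hp1 : p < 1) (hα0 : 0 < α) (n : ℕ) :
    1 - α < binomWeight p α n := by
  have h : 0 < p ^ n * ((n : ℝ) * (1 - p) + 1) := by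
    have : 0 ≤ (n : ℝ) * (1 - p) := mul_nonneg n.cast_nonneg (by linarith)
    positivity
  have h2 : ((n : ℝ) + 1) * p ^ n - n * p ^ (n + 1) = p ^ n * ((n : ℝ) * (1 - p) + 1) := by ring
  rw [binomWeight, h2]
  linarith [mul_pos hα0 h]

lemma binomWeight_pos (hp0 : 0 < p) (hp1 : p < 1) (hα0 : 0 < α) (hα1 : α < 1) (n : ℕ) :
    0 < binomWeight p α n := by
  linarith [binomWeight_lower_bound hp0 hp1 hα0 n]

lemma binomWeight_antitone (hp0 : 0 ≤ p) (hα0 : 0 ≤ α) : Antitone (binomWeight p α) := by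
  refine antitone_nat_of_succ_le fun n => ?_
  have h : binomWeight p α n - binomWeight p α (n + 1)
      = α * ((n + 1) * p ^ n * (1 - p) ^ 2) := by
    simp only [binomWeight]; push_cast; ring
  have : 0 ≤ α * ((n + 1) * p ^ n * (1 - p) ^ 2) := by positivity
  linarith

lemma abs_log_binomWeight_le (hp0 : 0 < p) (hp1 : p < 1) (hα0 : 0 < α) (hα1 : α < 1) (n : ℕ) :
    |Real.log (binomWeight p α n)| ≤ -Real.log (1 - α) := by
  have hpos := binomWeight_pos hp0 hp1 hα0 hα1 n
  have hle : binomWeight p α n ≤ 1 :=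
    binomWeight_zero p α ▸ binomWeight_antitone hp0.le hα0.le n.zero_le
  rw [abs_of_nonpos (Real.log_nonpos hpos.le hle)]
  exact neg_le_neg
    (Real.log_le_log (by linarith) (binomWeight_lower_bound hp0 hp1 hα0 n).le)

end binomWeight

lemma summable_div_succ_mul_succ_succ {a : ℕ → ℝ} {C : ℝ} (ha : ∀ n, |a n| ≤ C) :
    Summable fun i : ℕ => a i / (((i : ℝ) + 1) * ((i : ℝ) + 2)) := by
  have h2 : Summable fun i : ℕ => C * (1 / ((i + 1 : ℕ) : ℝ) ^ 2) :=
    ((summable_nat_add_iff 1).2 (Real.summable_one_div_nat_pow.2 one_lt_two)).mul_left C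
  refine h2.of_norm_bounded fun i => ?_
  have hC : 0 ≤ C := (abs_nonneg _).trans (ha 0)
  rw [Real.norm_eq_abs, abs_div, abs_of_pos (by positivity : 0 < ((i : ℝ) + 1) * ((i : ℝ) + 2)),
    mul_one_div]
  have : ((i + 1 : ℕ) : ℝ) ^ 2 ≤ ((i : ℝ) + 1) * ((i : ℝ) + 2) := by
    push_cast; nlinarith [(Nat.cast_nonneg i : (0 : ℝ) ≤ i)]
  have := ha i
  gcongr

/-- If `(u n / u (n + 1)) ^ (n + 1) = g (n + 1) / g n`, then summation by parts expresses `log u`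
through `log g`. -/
lemma log_eq_sub_sum_of_pow_ratio {u g : ℕ → ℝ} (hu : ∀ n, 0 < u n) (hg : ∀ n, 0 < g n)
    (hg0 : g 0 = 1) (h : ∀ n, (u n / u (n + 1)) ^ (n + 1) = g (n + 1) / g n) (n : ℕ) :
    Real.log (u n) = Real.log (u 0) - Real.log (g n) / ((n : ℝ) + 1)
      - ∑ i ∈ Finset.range n, Real.log (g (i + 1)) / (((i : ℝ) + 1) * ((i : ℝ) + 2)) := by
  induction n with
  | zero => simp [hg0]
  | succ n ih =>
    have h1 := congrArg Real.log (h n)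
    rw [Real.log_pow, Real.log_div (hu _).ne' (hu _).ne',
      Real.log_div (hg _).ne' (hg _).ne'] at h1
    rw [Finset.sum_range_succ]
    have h2 : Real.log (u (n + 1))
        = Real.log (u n) - (Real.log (g (n + 1)) - Real.log (g n)) / ((n : ℝ) + 1) := by
      push_cast at h1
      rw [← h1]; field_simp; ring
    rw [h2, ih]
    push_cast
    have h3 : (n : ℝ) + 1 + 1 ≠ 0 := by positivity
    have h4 : (n : ℝ) + 2 ≠ 0 := by positivity
    field_simp
    ring

lemma tendsto_of_pow_ratio {u g : ℕ → ℝ} {C : ℝ} (hu : ∀ n, 0 < u n) (hg : ∀ n, 0 < g n)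
    (hg0 : g 0 = 1) (hC : ∀ n, |Real.log (g n)| ≤ C)
    (h : ∀ n, (u n / u (n + 1)) ^ (n + 1) = g (n + 1) / g n) :
    Tendsto u atTop (𝓝 (Real.exp (Real.log (u 0)
      - ∑' i : ℕ, Real.log (g (i + 1)) / (((i : ℝ) + 1) * ((i : ℝ) + 2))))) := by
  have hsum := (summable_div_succ_mul_succ_succ fun n => hC (n + 1)).hasSum.tendsto_sum_nat
  have hz : Tendsto (fun n : ℕ => Real.log (g n) / ((n : ℝ) + 1)) atTop (𝓝 0) := by
    have hc := tendsto_one_div_add_atTop_nhds_zero_nat.const_mul C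
    rw [mul_zero] at hc
    refine squeeze_zero_norm (fun n => ?_) hc
    rw [Real.norm_eq_abs, abs_div, abs_of_pos (by positivity : 0 < (n : ℝ) + 1), mul_one_div]
    have := hC n
    gcongr
  have hlog := (tendsto_const_nhds (x := Real.log (u 0))).sub hz |>.sub hsum
  rw [sub_zero] at hlog
  refine ((Real.continuous_exp.tendsto _).comp hlog).congr fun n => ?_
  rw [Function.comp_apply, ← log_eq_sub_sum_of_pow_ratio hu hg hg0 h n, Real.exp_log (hu n)]

theorem stmt11 (p α : ℝ) (hp : p ∈ Set.Ioo (0 : ℝ) 1) (hα : α ∈ Set.Ioo (0 : ℝ) 1)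
    (γ : ℕ → ℝ)
    (hγ : ∀ k : ℕ, γ k = 1 - α + α * ((k : ℝ) * p ^ (k - 1) - ((k : ℝ) - 1) * p ^ k))
    (ts : ℕ → ℝ)
    (hts1 : ts 1 = p)
    (hts2 : ts 2 = p * Real.exp (α * (1 - p) ^ 2 / p))
    (htspos : ∀ k : ℕ, 1 ≤ k → 0 < ts k)
    (hrec : ∀ k : ℕ, 2 ≤ k → (ts k / ts (k + 1)) ^ (k - 1) = γ k / γ (k - 1)) :
    -- (i) the sequence is nondecreasing
    (∀ k : ℕ, 1 ≤ k → ts k ≤ ts (k + 1)) ∧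
    -- (ii) the limit of the (monotone) sequence is at most 1 iff the inequality holds,
    -- with limit equal to 1 exactly at equality
    ((∀ k : ℕ, 1 ≤ k → ts k ≤ 1) ↔
      Real.log p + α * (1 - p) ^ 2 / p ≤
        ∑' i : ℕ, Real.log (γ (i + 2)) / (((i : ℝ) + 1) * ((i : ℝ) + 2))) ∧
    (Filter.Tendsto ts Filter.atTop (nhds 1) ↔
      Real.log p + α * (1 - p) ^ 2 / p =
        ∑' i : ℕ, Real.log (γ (i + 2)) / (((i : ℝ) + 1) * ((i : ℝ) + 2))) ∧
    -- (iii) `T_i / ts i ^ (i-1) = p * γ (i-1)` for `i ≥ 2`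
    (∀ i : ℕ, 2 ≤ i →
      (∏ j ∈ Finset.Icc 1 i, ts j) / (ts i) ^ (i - 1) = p * γ (i - 1)) := by
  obtain ⟨hp0, hp1⟩ := hp
  obtain ⟨hα0, hα1⟩ := hα
  have hγ' : ∀ n, γ (n + 1) = binomWeight p α n := fun n => by
    rw [hγ, binomWeight]; push_cast; rw [add_sub_cancel_right]
  have hγpos : ∀ n, 0 < binomWeight p α n := binomWeight_pos hp0 hp1 hα0 hα1
  have hratio : ∀ n, (ts (n + 2) / ts (n + 3)) ^ (n + 1)
      = binomWeight p α (n + 1) / binomWeight p α n := fun n => by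
    rw [← hγ', ← hγ']; exact hrec (n + 2) (by omega)
  have hmono : ∀ k : ℕ, 1 ≤ k → ts k ≤ ts (k + 1) := by
    intro k hk
    obtain rfl | ⟨n, rfl⟩ : k = 1 ∨ ∃ n, k = n + 2 := by
      rcases hk.eq_or_lt with h | h
      · exact Or.inl h.symm
      · exact Or.inr ⟨k - 2, by omega⟩
    · rw [hts1, hts2]
      exact le_mul_of_one_le_right hp0.le (Real.one_le_exp (by positivity))
    · have hle : (ts (n + 2) / ts (n + 3)) ^ (n + 1) ≤ 1 := by
        rw [hratio, div_le_one (hγpos n)]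
        exact binomWeight_antitone hp0.le hα0.le n.le_succ
      have hpos := htspos (n + 3) (by omega)
      rwa [pow_le_one_iff_of_nonneg (div_pos (htspos _ (by omega)) hpos).le n.succ_ne_zero,
        div_le_one hpos] at hle
  have hlim := tendsto_of_pow_ratio (u := fun n => ts (n + 2)) (fun n => htspos _ (by omega))
    hγpos (binomWeight_zero p α) (abs_log_binomWeight_le hp0 hp1 hα0 hα1) hratio
  replace hlim := (tendsto_add_atTop_iff_nat 2).1 hlim
  have hlog : Real.log (ts (0 + 2)) = Real.log p + α * (1 - p) ^ 2 / p := by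
    rw [zero_add, hts2, Real.log_mul hp0.ne' (Real.exp_ne_zero _), Real.log_exp]
  simp only [hlog, ← hγ'] at hlim
  refine ⟨hmono, ?_, ?_, ?_⟩
  · rw [← sub_nonpos, ← Real.exp_le_one_iff]
    constructor
    · intro h
      exact le_of_tendsto hlim (eventually_atTop.2 ⟨1, h⟩)
    · intro h k hk
      have hmono' : Monotone fun n => ts (n + 1) :=
        monotone_nat_of_le_succ fun n => hmono (n + 1) (by omega)
      obtain ⟨n, rfl⟩ : ∃ n, k = n + 1 := ⟨k - 1, by omega⟩
      exact (hmono'.ge_of_tendsto ((tendsto_add_atTop_iff_nat 1).2 hlim) n).trans h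
  · rw [← sub_eq_zero, ← Real.exp_eq_one_iff]
    exact ⟨fun h => tendsto_nhds_unique hlim h, fun h => h ▸ hlim⟩
  · intro i hi
    obtain ⟨n, rfl⟩ : ∃ n, i = n + 2 := ⟨i - 2, by omega⟩
    change _ / ts (n + 2) ^ (n + 1) = p * γ (n + 1)
    rw [hγ']
    clear hi
    induction n with
    | zero =>
      have := (htspos 2 (by omega)).ne'
      rw [Finset.prod_Icc_succ_top (by omega)]
      simp [binomWeight_zero, hts1, this]
    | succ n ih =>
      have h2 := (htspos (n + 2) (by omega)).ne'
      have h3 := (htspos (n + 3) (by omega)).ne'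
      have hg := (hγpos n).ne'
      have hr := hratio n
      rw [div_pow, div_eq_div_iff (pow_ne_zero _ h3) hg] at hr
      rw [div_eq_iff (pow_ne_zero _ h2)] at ih
      rw [show n + 1 + 2 = n + 2 + 1 by ring, Finset.prod_Icc_succ_top (by omega), ih,
        div_eq_iff (pow_ne_zero _ h3), pow_succ (ts (n + 2 + 1))]
      linear_combination p * ts (n + 3) * hr
end

section
/- For every p ∈ (0,1) there exists a unique α̃ ∈ (0,1) satisfying ln p + α̃(1−p)²/p = ∑_{i=1}^∞ ln(1 − α̃ + α̃((i+1)p^i − i p^{i+1})) / (i(i+1)). Moreover, the map p ↦ α̃(p) defined by this equation is continuous on (0,1). -/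
/-- `rhsSeries p α = ∑_{i=1}^∞ ln(1 − α + α((i+1)pⁱ − i p^{i+1}))/(i(i+1))`
(reindexed so the sum runs over `i : ℕ` starting at `0`). -/
noncomputable def rhsSeries (p α : ℝ) : ℝ :=
  ∑' i : ℕ,
    Real.log (1 - α + α * (((i : ℝ) + 2) * p ^ (i + 1) - ((i : ℝ) + 1) * p ^ (i + 2))) /
      (((i : ℝ) + 1) * ((i : ℝ) + 2))

open Set Filter Topology

/-- The coefficient `(n+1)pⁿ − n p^{n+1}` at `n = i + 1`. -/
noncomputable def rhsCoeff (p : ℝ) (i : ℕ) : ℝ :=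
  ((i : ℝ) + 2) * p ^ (i + 1) - ((i : ℝ) + 1) * p ^ (i + 2)

/-- The `i`-th summand of `rhsSeries p α`. -/
noncomputable def rhsTerm (p α : ℝ) (i : ℕ) : ℝ :=
  Real.log (1 - α + α * rhsCoeff p i) / (((i : ℝ) + 1) * ((i : ℝ) + 2))

/-- The difference of the two sides of the equation defining `α`. -/
noncomputable def sideDiff (p α : ℝ) : ℝ :=
  Real.log p + α * (1 - p) ^ 2 / p - rhsSeries p α

theorem rhsSeries_eq_tsum (p α : ℝ) : rhsSeries p α = ∑' i, rhsTerm p α i := rfl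

theorem rhsCoeff_eq (p : ℝ) (i : ℕ) :
    rhsCoeff p i = p ^ (i + 1) * (1 + ((i + 1 : ℕ) : ℝ) * (1 - p)) := by
  unfold rhsCoeff
  push_cast
  ring

theorem rhsCoeff_pos {p : ℝ} (hp : p ∈ Ioo (0 : ℝ) 1) (i : ℕ) : 0 < rhsCoeff p i := by
  have h0 := hp.1
  have h1 : 0 < 1 - p := sub_pos.2 hp.2
  rw [rhsCoeff_eq]
  positivity

theorem rhsCoeff_le_one {p : ℝ} (hp : p ∈ Ioo (0 : ℝ) 1) (i : ℕ) : rhsCoeff p i ≤ 1 := by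
  have h0 := hp.1
  have h1 := hp.2
  rw [rhsCoeff_eq]
  calc p ^ (i + 1) * (1 + ((i + 1 : ℕ) : ℝ) * (1 - p))
      ≤ p ^ (i + 1) * (1 + (1 - p)) ^ (i + 1) := by
        gcongr
        exact one_add_mul_le_pow (by linarith) _
    _ = (p * (1 + (1 - p))) ^ (i + 1) := (mul_pow _ _ _).symm
    _ ≤ 1 := pow_le_one₀ (mul_nonneg h0.le (by linarith)) (by nlinarith [sq_nonneg (1 - p)])

theorem continuous_rhsCoeff (i : ℕ) : Continuous fun p => rhsCoeff p i := by
  unfold rhsCoeff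
  fun_prop

theorem one_sub_le_logArg {p α : ℝ} (hp : p ∈ Ioo (0 : ℝ) 1) (h0 : 0 ≤ α) (i : ℕ) :
    1 - α ≤ 1 - α + α * rhsCoeff p i :=
  le_add_of_nonneg_right (mul_nonneg h0 (rhsCoeff_pos hp i).le)

theorem logArg_pos {p α : ℝ} (hp : p ∈ Ioo (0 : ℝ) 1) (h0 : 0 ≤ α) (h1 : α ≤ 1) (i : ℕ) :
    0 < 1 - α + α * rhsCoeff p i := by
  rcases h1.lt_or_eq with h | rfl
  · exact (sub_pos.2 h).trans_le (one_sub_le_logArg hp h0 i)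
  · simpa using rhsCoeff_pos hp i

theorem logArg_le_one {p α : ℝ} (hp : p ∈ Ioo (0 : ℝ) 1) (h0 : 0 ≤ α) (i : ℕ) :
    1 - α + α * rhsCoeff p i ≤ 1 := by
  nlinarith [rhsCoeff_le_one hp i]

theorem rhsTerm_nonpos {p α : ℝ} (hp : p ∈ Ioo (0 : ℝ) 1) (h0 : 0 ≤ α) (h1 : α ≤ 1) (i : ℕ) :
    rhsTerm p α i ≤ 0 :=
  div_nonpos_of_nonpos_of_nonneg
    (Real.log_nonpos (logArg_pos hp h0 h1 i).le (logArg_le_one hp h0 i)) (by positivity)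

theorem summable_one_div_succ_mul (C : ℝ) :
    Summable fun i : ℕ => C / (((i : ℝ) + 1) * ((i : ℝ) + 2)) := by
  have h : Summable fun i : ℕ => 1 / (((i + 1 : ℕ) : ℝ) ^ 2) :=
    (summable_nat_add_iff 1).2 (Real.summable_one_div_nat_pow.2 one_lt_two)
  have h' : Summable fun i : ℕ => 1 / (((i : ℝ) + 1) * ((i : ℝ) + 2)) := by
    refine Summable.of_nonneg_of_le (fun i => by positivity) (fun i => ?_) h
    push_cast
    apply one_div_le_one_div_of_le (by positivity)
    nlinarith [(Nat.cast_nonneg i : (0 : ℝ) ≤ i)]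
  simpa [div_eq_mul_inv] using h'.mul_left C

theorem norm_rhsTerm_le {p α a : ℝ} (hp : p ∈ Ioo (0 : ℝ) 1) (h0 : 0 ≤ α) (ha : α ≤ a)
    (h1 : a < 1) (i : ℕ) :
    ‖rhsTerm p α i‖ ≤ -Real.log (1 - a) / (((i : ℝ) + 1) * ((i : ℝ) + 2)) := by
  rw [Real.norm_of_nonpos (rhsTerm_nonpos hp h0 (ha.trans h1.le) i), rhsTerm, ← neg_div]
  have : Real.log (1 - a) ≤ Real.log (1 - α + α * rhsCoeff p i) :=
    Real.log_le_log (sub_pos.2 h1)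
      ((sub_le_sub_left ha 1).trans (one_sub_le_logArg hp h0 i))
  gcongr

theorem summable_rhsTerm {p α : ℝ} (hp : p ∈ Ioo (0 : ℝ) 1) (h0 : 0 ≤ α) (h1 : α < 1) :
    Summable (rhsTerm p α) :=
  Summable.of_norm_bounded (summable_one_div_succ_mul _) (norm_rhsTerm_le hp h0 le_rfl h1)

theorem continuousAt_rhsTerm {p α : ℝ} (hp : p ∈ Ioo (0 : ℝ) 1) (h0 : 0 ≤ α) (h1 : α ≤ 1)
    (i : ℕ) : ContinuousAt (fun x : ℝ × ℝ => rhsTerm x.1 x.2 i) (p, α) := by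
  unfold rhsTerm
  have hc : Continuous fun x : ℝ × ℝ => 1 - x.2 + x.2 * rhsCoeff x.1 i :=
    (continuous_const.sub continuous_snd).add
      (continuous_snd.mul ((continuous_rhsCoeff i).comp continuous_fst))
  exact (hc.continuousAt.log (logArg_pos hp h0 h1 i).ne').div_const _

theorem continuousOn_sideDiff {a : ℝ} (ha : a < 1) :
    ContinuousOn (fun x : ℝ × ℝ => sideDiff x.1 x.2) (Ioo 0 1 ×ˢ Icc 0 a) := by
  have hS : ContinuousOn (fun x : ℝ × ℝ => rhsSeries x.1 x.2) (Ioo 0 1 ×ˢ Icc 0 a) := by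
    simp only [rhsSeries_eq_tsum]
    refine continuousOn_tsum (fun i x hx => ?_) (summable_one_div_succ_mul (-Real.log (1 - a)))
      (fun i x hx => norm_rhsTerm_le hx.1 hx.2.1 hx.2.2 ha i)
    exact (continuousAt_rhsTerm hx.1 hx.2.1 (hx.2.2.trans ha.le) i).continuousWithinAt
  have hne : ∀ x ∈ (Ioo 0 1 ×ˢ Icc 0 a : Set (ℝ × ℝ)), x.1 ≠ 0 := fun x hx => hx.1.1.ne'
  unfold sideDiff
  refine ContinuousOn.sub (ContinuousOn.add (ContinuousOn.log (by fun_prop) hne) ?_) hS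
  exact ContinuousOn.div (by fun_prop) (by fun_prop) hne

theorem strictMonoOn_sideDiff {p : ℝ} (hp : p ∈ Ioo (0 : ℝ) 1) :
    StrictMonoOn (sideDiff p) (Ico 0 1) := by
  intro α hα β hβ h
  have hS : rhsSeries p β ≤ rhsSeries p α := by
    simp only [rhsSeries_eq_tsum]
    refine (summable_rhsTerm hp hβ.1 hβ.2).tsum_le_tsum (fun i => ?_)
      (summable_rhsTerm hp hα.1 hα.2)
    unfold rhsTerm
    have := logArg_pos hp hβ.1 hβ.2.le i
    have : 1 - β + β * rhsCoeff p i ≤ 1 - α + α * rhsCoeff p i := by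
      nlinarith [rhsCoeff_le_one hp i]
    gcongr
  have hlin : α * (1 - p) ^ 2 / p < β * (1 - p) ^ 2 / p := by
    have h0 := hp.1
    have h1 : 0 < 1 - p := sub_pos.2 hp.2
    gcongr
  unfold sideDiff
  linarith

theorem sideDiff_zero_neg {p : ℝ} (hp : p ∈ Ioo (0 : ℝ) 1) : sideDiff p 0 < 0 := by
  simpa [sideDiff, rhsSeries] using Real.log_neg hp.1 hp.2

theorem eventually_rhsTerm_one_le {p : ℝ} (hp : p ∈ Ioo (0 : ℝ) 1) :
    ∀ᶠ i : ℕ in atTop, rhsTerm p 1 i ≤ Real.log (√p) * (((i + 2 : ℕ) : ℝ))⁻¹ := by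
  have hr0 : 0 < √p := Real.sqrt_pos.2 hp.1
  have hr1 : √p < 1 := by simpa using Real.sqrt_lt_sqrt hp.1.le hp.2
  have hlim : Tendsto (fun n : ℕ => (n : ℝ) * √p ^ n + √p ^ n) atTop (𝓝 (0 + 0)) :=
    (tendsto_self_mul_const_pow_of_lt_one hr0.le hr1).add
      (tendsto_pow_atTop_nhds_zero_of_lt_one hr0.le hr1)
  have hev := (tendsto_add_atTop_iff_nat 1).2 hlim
  filter_upwards [hev.eventually_le_const (u := 1) (by norm_num)] with i hi
  have hp2 : p ^ (i + 1) = √p ^ (i + 1) * √p ^ (i + 1) := by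
    rw [← mul_pow, Real.mul_self_sqrt hp.1.le]
  have hc : rhsCoeff p i ≤ √p ^ (i + 1) := by
    have h1 : 0 < ((i : ℝ) + 1) * p ^ (i + 2) := by
      have := hp.1
      positivity
    have h2 : ((i : ℝ) + 2) * √p ^ (i + 1) ≤ 1 := by
      push_cast at hi
      linarith
    have h3 := mul_le_mul_of_nonneg_right h2 (pow_pos hr0 (i + 1)).le
    unfold rhsCoeff
    rw [hp2]
    linarith
  have hlog := Real.log_le_log (rhsCoeff_pos hp i) hc
  rw [Real.log_pow] at hlog
  have hterm : rhsTerm p 1 i = Real.log (rhsCoeff p i) / (((i : ℝ) + 1) * ((i : ℝ) + 2)) := by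
    simp [rhsTerm]
  rw [hterm, div_le_iff₀ (by positivity)]
  refine hlog.trans (le_of_eq ?_)
  push_cast
  field_simp

theorem not_summable_rhsTerm_one {p : ℝ} (hp : p ∈ Ioo (0 : ℝ) 1) :
    ¬ Summable fun i => -rhsTerm p 1 i := by
  intro hs
  have hr : Real.log (√p) < 0 :=
    Real.log_neg (Real.sqrt_pos.2 hp.1) (by simpa using Real.sqrt_lt_sqrt hp.1.le hp.2)
  have hsum : Summable fun i : ℕ => -Real.log (√p) * (((i + 2 : ℕ) : ℝ))⁻¹ := by
    refine Summable.of_norm_bounded_eventually_nat hs ?_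
    filter_upwards [eventually_rhsTerm_one_le hp] with i hi
    rw [Real.norm_of_nonneg (mul_nonneg (by linarith) (by positivity))]
    linarith
  rw [summable_mul_left_iff (neg_ne_zero.2 hr.ne),
    summable_nat_add_iff (f := fun n : ℕ => ((n : ℝ))⁻¹) 2] at hsum
  exact Real.not_summable_natCast_inv hsum

theorem exists_sideDiff_pos {p : ℝ} (hp : p ∈ Ioo (0 : ℝ) 1) :
    ∃ a ∈ Ioo (0 : ℝ) 1, 0 < sideDiff p a := by
  have htop := (not_summable_iff_tendsto_nat_atTop_of_nonneg
    (fun i => neg_nonneg.2 (rhsTerm_nonpos hp zero_le_one le_rfl i))).1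
    (not_summable_rhsTerm_one hp)
  obtain ⟨N, hN⟩ := (htop.eventually_gt_atTop (-Real.log p)).exists
  have hcont : ContinuousAt (fun α => ∑ i ∈ Finset.range N, -rhsTerm p α i) 1 := by
    refine tendsto_finsetSum _ fun i _ => Tendsto.neg ?_
    exact ContinuousAt.comp (f := fun α : ℝ => (p, α))
      (continuousAt_rhsTerm hp zero_le_one le_rfl i) (by fun_prop)
  have hev : ∀ᶠ α in 𝓝[<] (1 : ℝ), -Real.log p < ∑ i ∈ Finset.range N, -rhsTerm p α i :=
    (hcont.eventually_const_lt hN).filter_mono nhdsWithin_le_nhds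
  obtain ⟨a, ha, haI⟩ := (hev.and (Ioo_mem_nhdsLT zero_lt_one)).exists
  refine ⟨a, haI, ?_⟩
  have hS := (summable_rhsTerm hp haI.1.le haI.2).neg.sum_le_tsum (Finset.range N)
    (fun i _ => neg_nonneg.2 (rhsTerm_nonpos hp haI.1.le haI.2.le i))
  rw [tsum_neg, ← rhsSeries_eq_tsum] at hS
  have hlin : 0 ≤ a * (1 - p) ^ 2 / p := by
    have h0 := hp.1
    have h1 := haI.1
    positivity
  unfold sideDiff
  linarith

theorem stmt12 :
    (∀ p ∈ Set.Ioo (0 : ℝ) 1, ∃! α : ℝ, α ∈ Set.Ioo (0 : ℝ) 1 ∧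
      Real.log p + α * (1 - p) ^ 2 / p = rhsSeries p α) ∧
    (∀ f : ℝ → ℝ,
      (∀ p ∈ Set.Ioo (0 : ℝ) 1, f p ∈ Set.Ioo (0 : ℝ) 1 ∧
        Real.log p + f p * (1 - p) ^ 2 / p = rhsSeries p (f p)) →
      ContinuousOn f (Set.Ioo (0 : ℝ) 1)) := by
  refine ⟨fun p hp => ?_, fun f hf p hp => ?_⟩
  · obtain ⟨a, ha, hpos⟩ := exists_sideDiff_pos hp
    have hcont : ContinuousOn (sideDiff p) (Icc 0 a) :=
      (continuousOn_sideDiff ha.2).comp (f := fun α : ℝ => (p, α)) (by fun_prop)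
        (fun α hα => ⟨hp, hα⟩)
    obtain ⟨α, hα, hzero⟩ :=
      intermediate_value_Ioo ha.1.le hcont ⟨sideDiff_zero_neg hp, hpos⟩
    refine ⟨α, ⟨⟨hα.1, hα.2.trans ha.2⟩, sub_eq_zero.1 hzero⟩, fun β hβ => ?_⟩
    exact (strictMonoOn_sideDiff hp).injOn (Ioo_subset_Ico_self hβ.1)
      ⟨hα.1.le, hα.2.trans ha.2⟩ ((sub_eq_zero.2 hβ.2).trans hzero.symm)
  · have hzero : ∀ q ∈ Ioo (0 : ℝ) 1, sideDiff q (f q) = 0 := fun q hq =>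
      sub_eq_zero.2 (hf q hq).2
    have hmem : ∀ q ∈ Ioo (0 : ℝ) 1, f q ∈ Ico (0 : ℝ) 1 := fun q hq =>
      Ioo_subset_Ico_self (hf q hq).1
    have hcont : ∀ a ∈ Ico (0 : ℝ) 1, ContinuousWithinAt (fun q => sideDiff q a) (Ioo 0 1) p :=
      fun a ha => (continuousOn_sideDiff ha.2).comp (f := fun q : ℝ => (q, a)) (by fun_prop)
        (fun q hq => ⟨hq, ha.1, le_rfl⟩) p hp
    refine tendsto_order.2 ⟨fun b hb => ?_, fun b hb => ?_⟩
    · have hm : max b 0 ∈ Ico (0 : ℝ) 1 :=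
        ⟨le_max_right _ _, max_lt (hb.trans (hf p hp).1.2) zero_lt_one⟩
      have hlt : sideDiff p (max b 0) < 0 :=
        (strictMonoOn_sideDiff hp hm (hmem p hp) (max_lt hb (hf p hp).1.1)).trans_eq (hzero p hp)
      filter_upwards [(hcont _ hm).eventually_lt_const hlt, self_mem_nhdsWithin] with q hq hqI
      have hlt' := ((strictMonoOn_sideDiff hqI).lt_iff_lt hm (hmem q hqI)).1
        (hq.trans_eq (hzero q hqI).symm)
      exact (le_max_left _ _).trans_lt hlt'
    · obtain ⟨c, hc, hc'⟩ := exists_between (lt_min hb (hf p hp).1.2)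
      have hm : c ∈ Ico (0 : ℝ) 1 :=
        ⟨((hf p hp).1.1.trans hc).le, hc'.trans_le (min_le_right _ _)⟩
      have hlt : 0 < sideDiff p c := by
        rw [← hzero p hp]
        exact strictMonoOn_sideDiff hp (hmem p hp) hm hc
      filter_upwards [(hcont _ hm).eventually_const_lt hlt, self_mem_nhdsWithin] with q hq hqI
      rw [← hzero q hqI, (strictMonoOn_sideDiff hqI).lt_iff_lt (hmem q hqI) hm] at hq
      exact hq.trans (hc'.trans_le (min_le_left _ _))
end

section
/- Let α̃(p) be defined for each p ∈ (0,1) as the unique solution in (0,1) of ln p + α̃(1−p)²/p = ∑_{i=1}^∞ ln(1 − α̃ + α̃((i+1)p^i − i p^{i+1}))/(i(i+1)), and let α* ∈ (0,1) be the unique solution of ∫_0^1 1/(y(1 − ln y) + 1/α* − 1) dy = 1. Then lim_{p→1⁻} α̃(p) = α*. -/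
open Real Set Filter Topology

/-- The integrand `1 / (y (1 - ln y) + c)`, with `c = 1 / α - 1` in the prophet equation. -/
noncomputable def prophetKernel (c y : ℝ) : ℝ := 1 / (y * (1 - log y) + c)

/-- The weight `(n+1) pⁿ - n p^{n+1}`. -/
noncomputable def geomWeight (p : ℝ) (n : ℕ) : ℝ := ((n : ℝ) + 1) * p ^ n - n * p ^ (n + 1)

lemma mul_one_sub_log_nonneg {y : ℝ} (hy : y ∈ Icc (0 : ℝ) 1) : 0 ≤ y * (1 - log y) :=
  mul_nonneg hy.1 (by linarith [log_nonpos hy.1 hy.2])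

lemma continuousOn_prophetKernel {c : ℝ} (hc : 0 < c) :
    ContinuousOn (prophetKernel c) (Icc 0 1) := by
  have h : Continuous fun y : ℝ => y * (1 - log y) := by
    have : (fun y : ℝ => y * (1 - log y)) = fun y => y - y * log y := by ext y; ring
    rw [this]
    exact continuous_id.sub continuous_mul_log
  exact continuousOn_const.div (h.add continuous_const).continuousOn
    fun y hy => by linarith [mul_one_sub_log_nonneg hy]

lemma intervalIntegrable_prophetKernel {c a b : ℝ} (hc : 0 < c) (ha : a ∈ Icc (0 : ℝ) 1)
    (hb : b ∈ Icc (0 : ℝ) 1) :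
    IntervalIntegrable (prophetKernel c) MeasureTheory.volume a b :=
  ((continuousOn_prophetKernel hc).mono (uIcc_subset_Icc ha hb)).intervalIntegrable

lemma integral_prophetKernel_lt {c d : ℝ} (hc : 0 < c) (hcd : c < d) :
    ∫ y in (0 : ℝ)..1, prophetKernel d y < ∫ y in (0 : ℝ)..1, prophetKernel c y := by
  have hlt : ∀ y ∈ Icc (0 : ℝ) 1, prophetKernel d y < prophetKernel c y := fun y hy =>
    one_div_lt_one_div_of_lt (by linarith [mul_one_sub_log_nonneg hy]) (by linarith)
  exact intervalIntegral.integral_lt_integral_of_continuousOn_of_le_of_exists_lt one_pos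
    (continuousOn_prophetKernel (hc.trans hcd)) (continuousOn_prophetKernel hc)
    (fun y hy => (hlt y (Ioc_subset_Icc_self hy)).le)
    ⟨0, left_mem_Icc.2 zero_le_one, hlt 0 (left_mem_Icc.2 zero_le_one)⟩

section Bounds

variable {p : ℝ}

lemma pow_mem_Icc (hp : p ∈ Ioo (0 : ℝ) 1) (n : ℕ) : p ^ n ∈ Icc (0 : ℝ) 1 :=
  ⟨pow_nonneg hp.1.le n, pow_le_one₀ hp.1.le hp.2.le⟩

lemma geomWeight_sub_succ (p : ℝ) (n : ℕ) :
    geomWeight p n - geomWeight p (n + 1) = (n + 1) * p ^ n * (1 - p) ^ 2 := by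
  simp only [geomWeight]
  push_cast
  ring

lemma geomWeight_pos (hp : p ∈ Ioo (0 : ℝ) 1) (n : ℕ) : 0 < geomWeight p n := by
  have : geomWeight p n = p ^ n * (1 + n * (1 - p)) := by simp only [geomWeight]; ring
  rw [this]
  have := mul_nonneg n.cast_nonneg (sub_nonneg.2 hp.2.le)
  exact mul_pos (pow_pos hp.1 n) (by linarith)

lemma geomWeight_le_one (hp : p ∈ Ioo (0 : ℝ) 1) (n : ℕ) : geomWeight p n ≤ 1 := by
  induction n with
  | zero => simp [geomWeight]
  | succ n ih =>
    have := geomWeight_sub_succ p n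
    have : 0 ≤ ((n : ℝ) + 1) * p ^ n * (1 - p) ^ 2 := by
      have := pow_nonneg hp.1.le n
      positivity
    linarith

lemma geomWeight_le (hp : p ∈ Ioo (0 : ℝ) 1) (n : ℕ) :
    geomWeight p n ≤ p ^ n * (1 - log (p ^ n)) := by
  have h : geomWeight p n = p ^ n * (1 + n * (1 - p)) := by simp only [geomWeight]; ring
  rw [h, log_pow]
  have := mul_le_mul_of_nonneg_left (log_le_sub_one_of_pos hp.1) n.cast_nonneg
  exact mul_le_mul_of_nonneg_left (by linarith) (pow_nonneg hp.1.le n)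

lemma mul_le_geomWeight (hp : p ∈ Ioo (0 : ℝ) 1) (n : ℕ) :
    p * (p ^ n * (1 - log (p ^ n))) ≤ geomWeight p n := by
  have h : geomWeight p n = p ^ n * (1 + n * (1 - p)) := by simp only [geomWeight]; ring
  rw [h, log_pow, mul_left_comm]
  refine mul_le_mul_of_nonneg_left ?_ (pow_nonneg hp.1.le n)
  have h1 := mul_le_mul_of_nonneg_left (one_sub_inv_le_log_of_pos hp.1) hp.1.le
  rw [mul_sub, mul_inv_cancel₀ hp.1.ne'] at h1
  have := mul_le_mul_of_nonneg_left h1 n.cast_nonneg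
  linarith [hp.2]

lemma mul_prophetKernel_le {c y : ℝ} (hc : 0 < c) (hp : p ∈ Ioo (0 : ℝ) 1) (n : ℕ)
    (hy : y ∈ Icc (p ^ (n + 1)) (p ^ n)) :
    p * prophetKernel c y ≤ 1 / (c + geomWeight p n) := by
  have hy0 : 0 < y := (pow_pos hp.1 _).trans_le hy.1
  have hy1 : y ∈ Icc (0 : ℝ) 1 := ⟨hy0.le, hy.2.trans (pow_mem_Icc hp n).2⟩
  have h1 : p ^ (n + 1) * (1 - log (p ^ n)) ≤ y * (1 - log y) :=
    mul_le_mul hy.1 (by linarith [log_le_log hy0 hy.2])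
      (by linarith [log_nonpos (pow_mem_Icc hp n).1 (pow_mem_Icc hp n).2]) hy0.le
  have h2 := mul_le_mul_of_nonneg_left (geomWeight_le hp n) hp.1.le
  rw [prophetKernel, mul_one_div, div_le_div_iff₀
    (by linarith [mul_one_sub_log_nonneg hy1]) (by linarith [geomWeight_pos hp n])]
  rw [pow_succ'] at h1
  nlinarith [hp.2]

lemma one_div_le_prophetKernel {c y : ℝ} (hc : 0 < c) (hp : p ∈ Ioo (0 : ℝ) 1) (n : ℕ)
    (hy : y ∈ Icc (p ^ (n + 1)) (p ^ n)) :
    p ^ 2 * (1 / (c + geomWeight p (n + 1))) ≤ prophetKernel c y := by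
  have hy0 : 0 < y := (pow_pos hp.1 _).trans_le hy.1
  have hy1 : y ∈ Icc (0 : ℝ) 1 := ⟨hy0.le, hy.2.trans (pow_mem_Icc hp n).2⟩
  have h1 : p * y * (1 - log y) ≤ p ^ (n + 1) * (1 - log (p ^ (n + 1))) :=
    mul_le_mul (by rw [pow_succ']; exact mul_le_mul_of_nonneg_left hy.2 hp.1.le)
      (by linarith [log_le_log (pow_pos hp.1 _) hy.1])
      (by linarith [log_nonpos hy1.1 hy1.2]) (pow_nonneg hp.1.le _)
  have h2 := mul_le_mul_of_nonneg_left h1 hp.1.le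
  have h3 := mul_le_geomWeight hp (n + 1)
  have h4 : p ^ 2 * c ≤ c := mul_le_of_le_one_left hc.le (pow_mem_Icc hp 2).2
  rw [prophetKernel, mul_one_div, div_le_div_iff₀ (by linarith [geomWeight_pos hp (n + 1)])
    (by linarith [mul_one_sub_log_nonneg hy1])]
  nlinarith

/-- Comparison of one logarithmic increment with the integral over the cell
`[p^{n+1}, pⁿ]`. -/
lemma log_increment_bounds {c : ℝ} (hc : 0 < c) (hp : p ∈ Ioo (0 : ℝ) 1) (n : ℕ) :
    (p * (1 - p)) * (∫ y in (p ^ (n + 1))..(p ^ n), prophetKernel c y) ≤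
        (log (c + geomWeight p n) - log (c + geomWeight p (n + 1))) / (n + 1) ∧
      p ^ 2 * ((log (c + geomWeight p n) - log (c + geomWeight p (n + 1))) / (n + 1)) ≤
        (1 - p) * ∫ y in (p ^ (n + 1))..(p ^ n), prophetKernel c y := by
  have hB := geomWeight_pos hp n
  have hB' := geomWeight_pos hp (n + 1)
  have hn : (0 : ℝ) < n + 1 := by positivity
  have hq : 0 < 1 - p := sub_pos.2 hp.2
  have hle : p ^ (n + 1) ≤ p ^ n := pow_le_pow_of_le_one hp.1.le hp.2.le n.le_succ
  have hint := intervalIntegrable_prophetKernel hc (pow_mem_Icc hp (n + 1)) (pow_mem_Icc hp n)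
  have hlow := intervalIntegral.integral_mono_on hle (hint.const_mul p)
    intervalIntegrable_const (fun y hy => mul_prophetKernel_le hc hp n hy)
  have hup := intervalIntegral.integral_mono_on hle
    intervalIntegrable_const hint
    (fun y hy => one_div_le_prophetKernel hc hp n hy)
  rw [intervalIntegral.integral_const, intervalIntegral.integral_const_mul, smul_eq_mul] at hlow
  rw [intervalIntegral.integral_const, smul_eq_mul] at hup
  have hdiff := geomWeight_sub_succ p n
  have hlog : log (c + geomWeight p n) - log (c + geomWeight p (n + 1)) =
      log ((c + geomWeight p n) / (c + geomWeight p (n + 1))) :=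
    (log_div (by linarith) (by linarith)).symm
  have hcell : p ^ n - p ^ (n + 1) = p ^ n * (1 - p) := by ring
  rw [hcell] at hlow hup
  constructor
  · have h := one_sub_inv_le_log_of_pos
      (div_pos (add_pos hc hB) (add_pos hc hB'))
    rw [← hlog, inv_div, one_sub_div (by linarith), add_sub_add_left_eq_sub, hdiff] at h
    rw [le_div_iff₀ hn]
    calc _ = (p * ∫ y in (p ^ (n + 1))..(p ^ n), prophetKernel c y) * ((1 - p) * (n + 1)) := by
          ring
      _ ≤ p ^ n * (1 - p) * (1 / (c + geomWeight p n)) * ((1 - p) * (n + 1)) := by gcongr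
      _ = (n + 1) * p ^ n * (1 - p) ^ 2 / (c + geomWeight p n) := by ring
      _ ≤ _ := h
  · have h := log_le_sub_one_of_pos
      (div_pos (add_pos hc hB) (add_pos hc hB'))
    rw [← hlog, div_sub_one (by linarith), add_sub_add_left_eq_sub, hdiff] at h
    calc _ ≤ p ^ 2 * (((n + 1) * p ^ n * (1 - p) ^ 2 / (c + geomWeight p (n + 1))) / (n + 1)) := by
          gcongr
      _ = (1 - p) * (p ^ n * (1 - p) * (p ^ 2 * (1 / (c + geomWeight p (n + 1))))) := by
          field_simp
      _ ≤ _ := by gcongr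

lemma sum_log_increment_bounds {c : ℝ} (hc : 0 < c) (hp : p ∈ Ioo (0 : ℝ) 1) (n : ℕ) :
    (p * (1 - p)) * (∫ y in (p ^ n)..1, prophetKernel c y) ≤
        ∑ i ∈ Finset.range n,
          (log (c + geomWeight p i) - log (c + geomWeight p (i + 1))) / (i + 1) ∧
      p ^ 2 * (∑ i ∈ Finset.range n,
          (log (c + geomWeight p i) - log (c + geomWeight p (i + 1))) / (i + 1)) ≤
        (1 - p) * ∫ y in (p ^ n)..1, prophetKernel c y := by
  induction n with
  | zero => simp
  | succ n ih =>
    have h := log_increment_bounds hc hp n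
    rw [Finset.sum_range_succ, ← intervalIntegral.integral_add_adjacent_intervals
      (intervalIntegrable_prophetKernel hc (pow_mem_Icc hp (n + 1)) (pow_mem_Icc hp n))
      (intervalIntegrable_prophetKernel hc (pow_mem_Icc hp n) (right_mem_Icc.2 zero_le_one)),
      mul_add, mul_add, mul_add]
    exact ⟨by linarith [h.1, ih.1], by linarith [h.2, ih.2]⟩

lemma tendsto_integral_prophetKernel {c : ℝ} (hc : 0 < c) (hp : p ∈ Ioo (0 : ℝ) 1) :
    Tendsto (fun n : ℕ => ∫ y in (p ^ n)..1, prophetKernel c y) atTop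
      (𝓝 (∫ y in (0 : ℝ)..1, prophetKernel c y)) := by
  have hcont := intervalIntegral.continuousOn_primitive_interval_left (a := 0) (b := 1)
    (f := prophetKernel c) (μ := MeasureTheory.volume)
    (by rw [uIcc_of_le zero_le_one]; exact (continuousOn_prophetKernel hc).integrableOn_Icc)
  rw [uIcc_of_le zero_le_one] at hcont
  exact (hcont 0 (left_mem_Icc.2 zero_le_one)).tendsto.comp
    (tendsto_nhdsWithin_iff.2 ⟨tendsto_pow_atTop_nhds_zero_of_lt_one hp.1.le hp.2,
      Eventually.of_forall (pow_mem_Icc hp)⟩)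

lemma sum_range_by_parts {L : ℕ → ℝ} (h0 : L 0 = 0) (n : ℕ) :
    ∑ i ∈ Finset.range n, -(L (i + 1) / (((i : ℝ) + 1) * ((i : ℝ) + 2))) =
      ∑ i ∈ Finset.range n, (L i - L (i + 1)) / ((i : ℝ) + 1) + L n / ((n : ℝ) + 1) := by
  induction n with
  | zero => simp [h0]
  | succ n ih =>
    rw [Finset.sum_range_succ, Finset.sum_range_succ, ih]
    have h1 : (n : ℝ) + 1 ≠ 0 := by positivity
    have h2 : (n : ℝ) + 2 ≠ 0 := by positivity
    have h3 : (n : ℝ) + 1 + 1 ≠ 0 := by positivity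
    push_cast
    field_simp
    ring

lemma neg_rhsSeries_bounds {α : ℝ} (hp : p ∈ Ioo (0 : ℝ) 1) (hα : α ∈ Ioo (0 : ℝ) 1) :
    (p * (1 - p)) * (∫ y in (0 : ℝ)..1, prophetKernel (1 / α - 1) y) ≤ -rhsSeries p α ∧
      p ^ 2 * -rhsSeries p α ≤
        (1 - p) * ∫ y in (0 : ℝ)..1, prophetKernel (1 / α - 1) y := by
  set c : ℝ := 1 / α - 1 with hcdef
  have hα0 := hα.1
  have hc : 0 < c := sub_pos.2 (one_lt_one_div hα.1 hα.2)
  have hαc : α * (c + 1) = 1 := by rw [hcdef]; field_simp; ring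
  let L : ℕ → ℝ := fun n => log (α * (c + geomWeight p n))
  have hL0 : L 0 = 0 := by simp [L, geomWeight, hαc]
  have hLle : ∀ n, L n ≤ 0 := fun n =>
    log_nonpos (mul_nonneg hα0.le (add_pos hc (geomWeight_pos hp n)).le)
      (by rw [← hαc]; gcongr; exact geomWeight_le_one hp n)
  have hLge : ∀ n, log (α * c) ≤ L n := fun n =>
    log_le_log (mul_pos hα0 hc) (by gcongr; linarith [geomWeight_pos hp n])
  have hLsub : ∀ n, L n - L (n + 1) =
      log (c + geomWeight p n) - log (c + geomWeight p (n + 1)) := fun n => by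
    simp only [L]
    rw [log_mul hα0.ne' (add_pos hc (geomWeight_pos hp n)).ne',
      log_mul hα0.ne' (add_pos hc (geomWeight_pos hp (n + 1))).ne']
    ring
  have hseries : -rhsSeries p α =
      ∑' i : ℕ, -(L (i + 1) / (((i : ℝ) + 1) * ((i : ℝ) + 2))) := by
    rw [rhsSeries, ← tsum_neg]
    refine tsum_congr fun i => ?_
    have : 1 - α + α * (((i : ℝ) + 2) * p ^ (i + 1) - ((i : ℝ) + 1) * p ^ (i + 2)) =
        α * (c + geomWeight p (i + 1)) := by
      simp only [geomWeight]
      push_cast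
      linear_combination -hαc
    rw [this]
  have hbounds := sum_log_increment_bounds hc hp
  simp only [← hLsub] at hbounds
  have htail : Tendsto (fun n : ℕ => L n / ((n : ℝ) + 1)) atTop (𝓝 0) := by
    have h1 : Tendsto (fun n : ℕ => log (α * c) / ((n : ℝ) + 1)) atTop (𝓝 0) :=
      tendsto_const_nhds.div_atTop (tendsto_natCast_atTop_atTop.atTop_add tendsto_const_nhds)
    exact tendsto_of_tendsto_of_tendsto_of_le_of_le h1 tendsto_const_nhds
      (fun n => div_le_div_of_nonneg_right (hLge n) (by positivity))
      (fun n => div_nonpos_of_nonpos_of_nonneg (hLle n) (by positivity))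
  have hlim := tendsto_integral_prophetKernel hc hp
  have hnonneg : ∀ i : ℕ, 0 ≤ -(L (i + 1) / (((i : ℝ) + 1) * ((i : ℝ) + 2))) := fun i =>
    neg_nonneg.2 (div_nonpos_of_nonpos_of_nonneg (hLle _) (by positivity))
  have hsum : Summable fun i : ℕ => -(L (i + 1) / (((i : ℝ) + 1) * ((i : ℝ) + 2))) := by
    obtain ⟨M, hM⟩ := hlim.bddAbove_range
    refine summable_of_sum_range_le (c := (1 - p) * M / p ^ 2) hnonneg fun n => ?_
    rw [sum_range_by_parts hL0]
    have h1 : L n / ((n : ℝ) + 1) ≤ 0 := div_nonpos_of_nonpos_of_nonneg (hLle n) (by positivity)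
    have h2 := mul_le_mul_of_nonneg_left (hM (mem_range_self n)) (sub_pos.2 hp.2).le
    have h3 := (le_div_iff₀' (pow_pos hp.1 2)).2 ((hbounds n).2.trans h2)
    linarith
  have hmain := hsum.hasSum.tendsto_sum_nat.sub htail
  simp only [sum_range_by_parts hL0, add_sub_cancel_right, sub_zero] at hmain
  rw [← hseries] at hmain
  exact ⟨le_of_tendsto_of_tendsto' (hlim.const_mul _) hmain fun n => (hbounds n).1,
    le_of_tendsto_of_tendsto' (hmain.const_mul _) (hlim.const_mul _) fun n => (hbounds n).2⟩

lemma integral_bounds_of_eq_rhsSeries {α : ℝ} (hp : p ∈ Ioo (0 : ℝ) 1)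
    (hα : α ∈ Ioo (0 : ℝ) 1) (h : log p + α * (1 - p) ^ 2 / p = rhsSeries p α) :
    p * (2 * p - 1) ≤ ∫ y in (0 : ℝ)..1, prophetKernel (1 / α - 1) y ∧
      ∫ y in (0 : ℝ)..1, prophetKernel (1 / α - 1) y ≤ 1 / p ^ 2 := by
  obtain ⟨h1, h2⟩ := neg_rhsSeries_bounds hp hα
  rw [← h] at h1 h2
  have hp0 := hp.1
  have hq : 0 < 1 - p := sub_pos.2 hp.2
  have hlog1 := log_le_sub_one_of_pos hp0
  have hlog2 := mul_le_mul_of_nonneg_left (one_sub_inv_le_log_of_pos hp0) hp0.le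
  rw [mul_sub, mul_inv_cancel₀ hp0.ne'] at hlog2
  have hterm : 0 ≤ α * (1 - p) ^ 2 / p := by have := hα.1; positivity
  constructor
  · have h3 : p * (α * (1 - p) ^ 2 / p) ≤ (1 - p) ^ 2 := by
      rw [mul_div_cancel₀ _ hp0.ne']
      exact mul_le_of_le_one_left (sq_nonneg _) hα.2.le
    refine le_of_mul_le_mul_left (le_trans ?_ h2) hq
    have h4 := mul_le_mul_of_nonneg_left h3 hp0.le
    have h5 := mul_le_mul_of_nonneg_left hlog1 (sq_nonneg p)
    linarith
  · rw [le_div_iff₀' (pow_pos hp0 2)]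
    refine le_of_mul_le_mul_left ?_ hq
    have h3 := mul_le_mul_of_nonneg_left h1 hp0.le
    have h4 := mul_nonneg hp0.le hterm
    linarith

end Bounds

theorem stmt13 (f : ℝ → ℝ)
    (hf : ∀ p ∈ Set.Ioo (0 : ℝ) 1, f p ∈ Set.Ioo (0 : ℝ) 1 ∧
      Real.log p + f p * (1 - p) ^ 2 / p = rhsSeries p (f p))
    (αs : ℝ) (hαs : αs ∈ Set.Ioo (0 : ℝ) 1)
    (hαs_eq : (∫ y in (0 : ℝ)..1, 1 / (y * (1 - Real.log y) + 1 / αs - 1)) = 1) :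
    Filter.Tendsto f (nhdsWithin 1 (Set.Iio 1)) (nhds αs) := by
  let I : ℝ → ℝ := fun α => ∫ y in (0 : ℝ)..1, prophetKernel (1 / α - 1) y
  have hmono : StrictMonoOn I (Ioo 0 1) := fun a ha b hb hab =>
    integral_prophetKernel_lt (sub_pos.2 (one_lt_one_div hb.1 hb.2))
      (sub_lt_sub_right (one_div_lt_one_div_of_lt ha.1 hab) 1)
  have hI : I αs = 1 := by simpa only [I, prophetKernel, ← add_sub_assoc] using hαs_eq
  have hmem : ∀ᶠ p in 𝓝[<] (1 : ℝ), p ∈ Ioo (0 : ℝ) 1 := Ioo_mem_nhdsLT one_pos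
  have hlim : Tendsto (fun p => I (f p)) (𝓝[<] 1) (𝓝 (I αs)) := by
    have hlow : Tendsto (fun p : ℝ => p * (2 * p - 1)) (𝓝[<] 1) (𝓝 1) := by
      have : ContinuousAt (fun p : ℝ => p * (2 * p - 1)) 1 := by fun_prop
      convert this.tendsto.mono_left nhdsWithin_le_nhds using 2
      norm_num
    have hup : Tendsto (fun p : ℝ => 1 / p ^ 2) (𝓝[<] 1) (𝓝 1) := by
      have : ContinuousAt (fun p : ℝ => 1 / p ^ 2) 1 := by fun_prop (disch := norm_num)
      convert this.tendsto.mono_left nhdsWithin_le_nhds using 2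
      norm_num
    rw [hI]
    refine tendsto_of_tendsto_of_tendsto_of_le_of_le' hlow hup ?_ ?_
    · filter_upwards [hmem] with p hp
      exact (integral_bounds_of_eq_rhsSeries hp (hf p hp).1 (hf p hp).2).1
    · filter_upwards [hmem] with p hp
      exact (integral_bounds_of_eq_rhsSeries hp (hf p hp).1 (hf p hp).2).2
  refine tendsto_order.2 ⟨fun a ha => ?_, fun a ha => ?_⟩
  · rcases le_or_gt a 0 with ha0 | ha0
    · filter_upwards [hmem] with p hp
      exact ha0.trans_lt (hf p hp).1.1
    · have ha' : a ∈ Ioo (0 : ℝ) 1 := ⟨ha0, ha.trans hαs.2⟩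
      filter_upwards [hmem, hlim.eventually_const_lt (hmono ha' hαs ha)] with p hp h
      exact (hmono.lt_iff_lt ha' (hf p hp).1).1 h
  · rcases le_or_gt 1 a with ha1 | ha1
    · filter_upwards [hmem] with p hp
      exact (hf p hp).1.2.trans_le ha1
    · have ha' : a ∈ Ioo (0 : ℝ) 1 := ⟨hαs.1.trans ha, ha1⟩
      filter_upwards [hmem, hlim.eventually_lt_const (hmono hαs ha' ha)] with p hp h
      exact (hmono.lt_iff_lt (hf p hp).1 ha').1 h
end

section
/- Let p ∈ (0,1), let α̃ ∈ (0,1) satisfy ln p + α̃(1−p)²/p = ∑_{i=1}^∞ ln(1 − α̃ + α̃((i+1)p^i − i p^{i+1}))/(i(i+1)), and let α* ∈ (0,1) satisfy ∫_0^1 1/(y(1 − ln y) + 1/α* − 1) dy = 1. Then α̃ ≥ α* · p. -/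
/-- The function `s ↦ 1 - α + α e^{-s} (1 + s)`, i.e. `α (y (1 - ln y) + 1/α - 1)` at
`y = e^{-s}`. -/
noncomputable def prophetWeight (α s : ℝ) : ℝ := 1 - α + α * (Real.exp (-s) * (1 + s))

/-- The incomplete integral `∫₀^y du / (u (1 - ln u) + 1/α - 1)`. -/
noncomputable def prophetIntegral (α y : ℝ) : ℝ :=
  ∫ u in (0 : ℝ)..y, 1 / (u * (1 - Real.log u) + 1 / α - 1)

/-- A primitive of `s ↦ ln (prophetWeight α s) / s²` on `(0, ∞)`. -/
noncomputable def prophetPrimitive (α s : ℝ) : ℝ :=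
  -Real.log (prophetWeight α s) / s + prophetIntegral α (Real.exp (-s))

lemma exp_neg_mul_one_add_le_one (s : ℝ) : Real.exp (-s) * (1 + s) ≤ 1 := by
  have h := Real.add_one_le_exp s
  have h2 : Real.exp (-s) * Real.exp s = 1 := by rw [← Real.exp_add]; simp
  nlinarith [Real.exp_pos (-s)]

lemma prophetWeight_le_one {α : ℝ} (h0 : 0 < α) (s : ℝ) : prophetWeight α s ≤ 1 := by
  have := exp_neg_mul_one_add_le_one s
  unfold prophetWeight
  nlinarith

lemma prophetWeight_pos {α s : ℝ} (h0 : 0 < α) (h1 : α < 1) (hs : 0 ≤ s) :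
    0 < prophetWeight α s := by
  have : 0 ≤ α * (Real.exp (-s) * (1 + s)) := by positivity
  unfold prophetWeight
  linarith

lemma hasDerivAt_prophetWeight (α s : ℝ) :
    HasDerivAt (prophetWeight α) (-(α * (s * Real.exp (-s)))) s := by
  have he : HasDerivAt (fun s : ℝ => Real.exp (-s)) (Real.exp (-s) * (-1)) s :=
    (hasDerivAt_neg s).exp
  have h := ((he.mul ((hasDerivAt_id s).const_add 1)).const_mul α).const_add (1 - α)
  refine h.congr_deriv ?_
  simp only [id]
  ring

lemma prophetDenom_pos {α u : ℝ} (h0 : 0 < α) (h1 : α < 1) (hu : u ∈ Set.Icc (0 : ℝ) 1) :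
    0 < u * (1 - Real.log u) + 1 / α - 1 := by
  have h2 : 1 < 1 / α := by rw [lt_div_iff₀ h0]; linarith
  have h3 := Real.log_nonpos hu.1 hu.2
  have : 0 ≤ u * (1 - Real.log u) := mul_nonneg hu.1 (by linarith)
  linarith

lemma continuous_prophetDenom (α : ℝ) :
    Continuous fun u : ℝ => u * (1 - Real.log u) + 1 / α - 1 := by
  have : (fun u : ℝ => u * (1 - Real.log u) + 1 / α - 1)
      = fun u : ℝ => u - u * Real.log u + 1 / α - 1 := by
    funext u; ring
  rw [this]
  exact ((continuous_id.sub Real.continuous_mul_log).add continuous_const).sub continuous_const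

lemma intervalIntegrable_prophetDenom {α a b : ℝ} (h0 : 0 < α) (h1 : α < 1)
    (ha : a ∈ Set.Icc (0 : ℝ) 1) (hb : b ∈ Set.Icc (0 : ℝ) 1) :
    IntervalIntegrable (fun u : ℝ => 1 / (u * (1 - Real.log u) + 1 / α - 1))
      MeasureTheory.volume a b := by
  refine ContinuousOn.intervalIntegrable fun u hu => ?_
  have hu' : u ∈ Set.Icc (0 : ℝ) 1 := Set.ordConnected_Icc.uIcc_subset ha hb hu
  exact (continuousAt_const.div (continuous_prophetDenom α).continuousAt
    (prophetDenom_pos h0 h1 hu').ne').continuousWithinAt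

lemma hasDerivAt_prophetIntegral {α y : ℝ} (h0 : 0 < α) (h1 : α < 1)
    (hy : y ∈ Set.Icc (0 : ℝ) 1) :
    HasDerivAt (prophetIntegral α) (1 / (y * (1 - Real.log y) + 1 / α - 1)) y := by
  refine intervalIntegral.integral_hasDerivAt_right
    (intervalIntegrable_prophetDenom h0 h1 ⟨le_rfl, zero_le_one⟩ hy) ?_
    (continuousAt_const.div (continuous_prophetDenom α).continuousAt
      (prophetDenom_pos h0 h1 hy).ne')
  exact (measurable_const.div
    (continuous_prophetDenom α).measurable).stronglyMeasurable.stronglyMeasurableAtFilter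

lemma prophetIntegral_le {α x y : ℝ} (h0 : 0 < α) (h1 : α < 1) (hx : 0 ≤ x) (hxy : x ≤ y)
    (hy : y ≤ 1) : prophetIntegral α x ≤ prophetIntegral α y := by
  have hadd := intervalIntegral.integral_add_adjacent_intervals
    (intervalIntegrable_prophetDenom h0 h1 ⟨le_rfl, zero_le_one⟩ ⟨hx, hxy.trans hy⟩)
    (intervalIntegrable_prophetDenom h0 h1 ⟨hx, hxy.trans hy⟩ ⟨hx.trans hxy, hy⟩)
  have hnn := intervalIntegral.integral_nonneg (μ := MeasureTheory.volume) hxy fun u hu =>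
    (one_div_pos.2 (prophetDenom_pos h0 h1 ⟨hx.trans hu.1, hu.2.trans hy⟩)).le
  unfold prophetIntegral
  linarith

lemma hasDerivAt_prophetIntegral_exp_neg {α s : ℝ} (h0 : 0 < α) (h1 : α < 1) (hs : 0 ≤ s) :
    HasDerivAt (fun s => prophetIntegral α (Real.exp (-s)))
      (-(α * Real.exp (-s) / prophetWeight α s)) s := by
  have he : HasDerivAt (fun s : ℝ => Real.exp (-s)) (Real.exp (-s) * (-1)) s :=
    (hasDerivAt_neg s).exp
  have hmem : Real.exp (-s) ∈ Set.Icc (0 : ℝ) 1 :=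
    ⟨(Real.exp_pos _).le, Real.exp_le_one_iff.2 (by linarith)⟩
  refine ((hasDerivAt_prophetIntegral h0 h1 hmem).comp s he).congr_deriv ?_
  have hH := prophetWeight_pos h0 h1 hs
  have hD : Real.exp (-s) * (1 - Real.log (Real.exp (-s))) + 1 / α - 1
      = prophetWeight α s / α := by
    rw [Real.log_exp, prophetWeight]
    field_simp
    ring
  rw [hD]
  field_simp

lemma hasDerivAt_log_prophetWeight {α s : ℝ} (h0 : 0 < α) (h1 : α < 1) (hs : 0 ≤ s) :
    HasDerivAt (fun s => Real.log (prophetWeight α s))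
      (-(α * (s * Real.exp (-s))) / prophetWeight α s) s :=
  (hasDerivAt_prophetWeight α s).log (prophetWeight_pos h0 h1 hs).ne'

lemma hasDerivAt_prophetPrimitive {α s : ℝ} (h0 : 0 < α) (h1 : α < 1) (hs : 0 < s) :
    HasDerivAt (prophetPrimitive α) (Real.log (prophetWeight α s) / s ^ 2) s := by
  have hH := prophetWeight_pos h0 h1 hs.le
  refine (((hasDerivAt_log_prophetWeight h0 h1 hs.le).neg.div (hasDerivAt_id s) hs.ne').add
    (hasDerivAt_prophetIntegral_exp_neg h0 h1 hs.le)).congr_deriv ?_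
  simp only [id, Pi.neg_apply]
  field_simp
  ring

lemma prophetPrimitive_nonneg {α s : ℝ} (h0 : 0 < α) (h1 : α < 1) (hs : 0 < s) :
    0 ≤ prophetPrimitive α s := by
  have hlog := Real.log_nonpos (prophetWeight_pos h0 h1 hs.le).le (prophetWeight_le_one h0 s)
  have hint := prophetIntegral_le h0 h1 le_rfl (Real.exp_pos (-s)).le
    (Real.exp_le_one_iff.2 (by linarith))
  have hzero : prophetIntegral α 0 = 0 := intervalIntegral.integral_same
  have : 0 ≤ -Real.log (prophetWeight α s) / s := div_nonneg (by linarith) hs.le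
  unfold prophetPrimitive
  linarith

lemma prophetPrimitive_le {α s : ℝ} (h0 : 0 < α) (h1 : α < 1) (hs : 0 < s) :
    prophetPrimitive α s ≤ prophetIntegral α 1 := by
  let R : ℝ → ℝ := fun s =>
    s * (prophetIntegral α 1 - prophetIntegral α (Real.exp (-s))) +
      Real.log (prophetWeight α s)
  have hR : ∀ x, 0 ≤ x →
      HasDerivAt R (prophetIntegral α 1 - prophetIntegral α (Real.exp (-x))) x := by
    intro x hx
    refine (((hasDerivAt_id x).mul
      ((hasDerivAt_prophetIntegral_exp_neg h0 h1 hx).const_sub (prophetIntegral α 1))).add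
        (hasDerivAt_log_prophetWeight h0 h1 hx)).congr_deriv ?_
    have hH := prophetWeight_pos h0 h1 hx
    simp only [id]
    field_simp
    ring
  have hmono : MonotoneOn R (Set.Ici 0) := by
    refine monotoneOn_of_deriv_nonneg (convex_Ici 0)
      (fun x hx => (hR x hx).continuousAt.continuousWithinAt)
      (fun x hx => (hR x (interior_subset hx)).differentiableAt.differentiableWithinAt) ?_
    intro x hx
    have hx0 : (0 : ℝ) ≤ x := interior_subset hx
    rw [(hR x hx0).deriv]
    linarith [prophetIntegral_le h0 h1 (Real.exp_pos (-x)).le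
      (Real.exp_le_one_iff.2 (by linarith)) le_rfl]
  have h := hmono (Set.mem_Ici.2 le_rfl) (Set.mem_Ici.2 hs.le) hs.le
  have hRz : R 0 = 0 := by simp [R, prophetWeight]
  rw [hRz] at h
  have hdiv : -Real.log (prophetWeight α s) / s
      ≤ prophetIntegral α 1 - prophetIntegral α (Real.exp (-s)) := by
    rw [div_le_iff₀ hs]
    simp only [R] at h
    linarith
  unfold prophetPrimitive
  linarith

/-- Jensen's inequality for `ln` and the weight `1 / s²` on `[a, b]`, against which
`prophetWeight α` has mean `1 - α x`. -/
lemma prophetPrimitive_sub_le {α a b x : ℝ} (h0 : 0 < α) (h1 : α < 1) (ha : 0 < a)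
    (hab : a ≤ b) (hx : 0 < 1 - α * x)
    (hmean : (1 - Real.exp (-a)) / a - (1 - Real.exp (-b)) / b = x * (1 / a - 1 / b)) :
    prophetPrimitive α b - prophetPrimitive α a ≤ (1 / a - 1 / b) * Real.log (1 - α * x) := by
  set h := 1 - α * x with hh
  let B : ℝ → ℝ := fun s =>
    (-(Real.log h - 1 + 1 / h) + α / h * (1 - Real.exp (-s))) / s - prophetPrimitive α s
  have hB : ∀ s, 0 < s → HasDerivAt B
      ((Real.log h + (prophetWeight α s - h) / h - Real.log (prophetWeight α s)) / s ^ 2) s := by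
    intro s hs
    have he : HasDerivAt (fun s : ℝ => Real.exp (-s)) (Real.exp (-s) * (-1)) s :=
      (hasDerivAt_neg s).exp
    refine (((((he.const_sub 1).const_mul (α / h)).const_add
      (-(Real.log h - 1 + 1 / h))).div (hasDerivAt_id s) hs.ne').sub
        (hasDerivAt_prophetPrimitive h0 h1 hs)).congr_deriv ?_
    simp only [id, prophetWeight]
    field_simp
    ring
  have hmono : MonotoneOn B (Set.Ici a) := by
    refine monotoneOn_of_deriv_nonneg (convex_Ici a)
      (fun s hs => (hB s (ha.trans_le hs)).continuousAt.continuousWithinAt)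
      (fun s hs =>
        (hB s (ha.trans_le (interior_subset hs))).differentiableAt.differentiableWithinAt) ?_
    intro s hs
    have hs0 : 0 < s := ha.trans_le (interior_subset hs)
    rw [(hB s hs0).deriv]
    have hH := prophetWeight_pos h0 h1 hs0.le
    have hlog := Real.log_le_sub_one_of_pos (div_pos hH hx)
    rw [Real.log_div hH.ne' hx.ne'] at hlog
    have : (prophetWeight α s - h) / h = prophetWeight α s / h - 1 := by
      rw [sub_div, div_self hx.ne']
    exact div_nonneg (by linarith) (by positivity)
  have hBab := hmono (Set.mem_Ici.2 le_rfl) (Set.mem_Ici.2 hab) hab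
  have hval : (-(Real.log h - 1 + 1 / h) + α / h * (1 - Real.exp (-b))) / b
      - (-(Real.log h - 1 + 1 / h) + α / h * (1 - Real.exp (-a))) / a
      = (1 / a - 1 / b) * Real.log h := by
    have hrw : (-(Real.log h - 1 + 1 / h) + α / h * (1 - Real.exp (-b))) / b
        - (-(Real.log h - 1 + 1 / h) + α / h * (1 - Real.exp (-a))) / a
        = (Real.log h - 1 + 1 / h) * (1 / a - 1 / b)
          - α / h * ((1 - Real.exp (-a)) / a - (1 - Real.exp (-b)) / b) := by ring
    rw [hrw, hmean]
    have hone : 1 / h - α / h * x = 1 := by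
      field_simp
      linarith
    linear_combination (1 / a - 1 / b) * hone
  simp only [B] at hBab
  linarith

/-- The defect `1 - ((i + 2) p^{i+1} - (i + 1) p^{i+2})`. -/
noncomputable def powDefect (p : ℝ) (i : ℕ) : ℝ :=
  1 - (((i : ℝ) + 2) * p ^ (i + 1) - ((i : ℝ) + 1) * p ^ (i + 2))

lemma powDefect_div (p : ℝ) (i : ℕ) :
    powDefect p i / (((i : ℝ) + 1) * ((i : ℝ) + 2))
      = (1 - p ^ (i + 1)) / ((i : ℝ) + 1) - (1 - p ^ (i + 2)) / ((i : ℝ) + 2) := by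
  unfold powDefect
  field_simp
  ring

lemma powDefect_nonneg {p : ℝ} (hp : 0 ≤ p) (i : ℕ) : 0 ≤ powDefect p i := by
  induction i with
  | zero => simp only [powDefect]; norm_num; nlinarith [sq_nonneg (1 - p)]
  | succ n ih =>
    have : powDefect p (n + 1) = powDefect p n + ((n : ℝ) + 2) * p ^ (n + 1) * (1 - p) ^ 2 := by
      unfold powDefect
      push_cast
      ring
    rw [this]
    positivity

lemma powDefect_le_one {p : ℝ} (hp : 0 ≤ p) (hp1 : p ≤ 1) (i : ℕ) : powDefect p i ≤ 1 := by
  have : powDefect p i = 1 - p ^ (i + 1) * (1 + ((i : ℝ) + 1) * (1 - p)) := by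
    unfold powDefect
    ring
  have hq : 0 ≤ 1 - p := by linarith
  have : 0 ≤ p ^ (i + 1) * (1 + ((i : ℝ) + 1) * (1 - p)) := by positivity
  linarith

lemma sum_powDefect_div (p : ℝ) (n : ℕ) :
    ∑ i ∈ Finset.range n, powDefect p i / (((i : ℝ) + 1) * ((i : ℝ) + 2))
      = (1 - p) - (1 - p ^ (n + 1)) / ((n : ℝ) + 1) := by
  induction n with
  | zero => simp
  | succ n ih =>
    rw [Finset.sum_range_succ, ih, powDefect_div]
    push_cast
    ring

lemma log_le_sum_log {p α : ℝ} (hp : p ∈ Set.Ioo (0 : ℝ) 1) (h0 : 0 < α) (h1 : α < 1)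
    (hα : prophetIntegral α 1 = 1) (n : ℕ) :
    Real.log p ≤ ∑ i ∈ Finset.range n,
      Real.log (1 - α * powDefect p i) / (((i : ℝ) + 1) * ((i : ℝ) + 2)) := by
  obtain ⟨hp0, hp1⟩ := hp
  set l := -Real.log p with hl
  have hlpos : 0 < l := by have := Real.log_neg hp0 hp1; linarith
  have hexp : ∀ k : ℕ, Real.exp (-(l * k)) = p ^ k := by
    intro k
    rw [hl, show -(-Real.log p * (k : ℝ)) = k * Real.log p by ring, Real.exp_nat_mul,
      Real.exp_log hp0]
  have hstep : ∀ i : ℕ, l * (prophetPrimitive α (l * ((i : ℝ) + 2))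
      - prophetPrimitive α (l * ((i : ℝ) + 1)))
      ≤ Real.log (1 - α * powDefect p i) / (((i : ℝ) + 1) * ((i : ℝ) + 2)) := by
    intro i
    have hx0 := powDefect_nonneg hp0.le i
    have hx1 := powDefect_le_one hp0.le hp1.le i
    have hea := hexp (i + 1)
    have heb := hexp (i + 2)
    push_cast at hea heb
    have hJ := prophetPrimitive_sub_le (x := powDefect p i) h0 h1
      (show 0 < l * ((i : ℝ) + 1) by positivity)
      (show l * ((i : ℝ) + 1) ≤ l * ((i : ℝ) + 2) by nlinarith) (by nlinarith) (by
        have hd := powDefect_div p i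
        rw [hea, heb]
        have hw : 1 / (l * ((i : ℝ) + 1)) - 1 / (l * ((i : ℝ) + 2))
          = 1 / l * (1 / (((i : ℝ) + 1) * ((i : ℝ) + 2))) := by
          field_simp
          ring
        rw [hw, show powDefect p i * (1 / l * (1 / (((i : ℝ) + 1) * ((i : ℝ) + 2))))
          = 1 / l * (powDefect p i / (((i : ℝ) + 1) * ((i : ℝ) + 2))) by ring, hd]
        field_simp)
    refine (mul_le_mul_of_nonneg_left hJ hlpos.le).trans_eq ?_
    field_simp
    ring
  have htel : l * (prophetPrimitive α (l * ((n : ℝ) + 1)) - prophetPrimitive α l)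
      = ∑ i ∈ Finset.range n, l * (prophetPrimitive α (l * ((i : ℝ) + 2))
        - prophetPrimitive α (l * ((i : ℝ) + 1))) := by
    induction n with
    | zero => simp
    | succ n ih =>
      rw [Finset.sum_range_succ, ← ih]
      push_cast
      rw [show (n : ℝ) + 1 + 1 = n + 2 by ring]
      ring
  have hsum := Finset.sum_le_sum fun i (_ : i ∈ Finset.range n) => hstep i
  rw [← htel] at hsum
  have hnn := prophetPrimitive_nonneg h0 h1 (show 0 < l * ((n : ℝ) + 1) by positivity)
  have hle := prophetPrimitive_le h0 h1 hlpos
  rw [hα] at hle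
  have : -l ≤ l * (prophetPrimitive α (l * ((n : ℝ) + 1)) - prophetPrimitive α l) := by
    nlinarith
  linarith

lemma log_one_sub_add_le {u v : ℝ} (hu : 0 ≤ u) (huv : u ≤ v) (hv : v < 1) :
    Real.log (1 - v) + (v - u) ≤ Real.log (1 - u) := by
  have h := Real.log_le_sub_one_of_pos (div_pos (sub_pos.2 hv) (sub_pos.2 (huv.trans_lt hv)))
  rw [Real.log_div (by linarith) (by linarith)] at h
  have h2 : (1 - v) / (1 - u) - 1 ≤ -(v - u) := by
    rw [sub_le_iff_le_add, div_le_iff₀ (by linarith)]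
    nlinarith
  linarith

theorem stmt15 (p : ℝ) (hp : p ∈ Set.Ioo (0 : ℝ) 1)
    (αt : ℝ) (hαt : αt ∈ Set.Ioo (0 : ℝ) 1)
    (hαt_eq : Real.log p + αt * (1 - p) ^ 2 / p = rhsSeries p αt)
    (αs : ℝ) (hαs : αs ∈ Set.Ioo (0 : ℝ) 1)
    (hαs_eq : (∫ y in (0 : ℝ)..1, 1 / (y * (1 - Real.log y) + 1 / αs - 1)) = 1) :
    αs * p ≤ αt := by
  by_contra! hlt
  obtain ⟨hp0, hp1⟩ := hp
  obtain ⟨ht0, ht1⟩ := hαt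
  obtain ⟨hs0, hs1⟩ := hαs
  let T : ℕ → ℝ := fun i =>
    Real.log (1 - αt * powDefect p i) / (((i : ℝ) + 1) * ((i : ℝ) + 2))
  have hrhs : rhsSeries p αt = ∑' i, T i := by
    unfold rhsSeries
    refine tsum_congr fun i => ?_
    simp only [T, powDefect]
    congr 2
    ring
  have hterm : ∀ i, Real.log (1 - αs * powDefect p i) / (((i : ℝ) + 1) * ((i : ℝ) + 2))
      + αs * (1 - p) * (powDefect p i / (((i : ℝ) + 1) * ((i : ℝ) + 2))) ≤ T i := by
    intro i
    have hx0 := powDefect_nonneg hp0.le i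
    have hx1 := powDefect_le_one hp0.le hp1.le i
    have hle : αt * powDefect p i ≤ αs * p * powDefect p i :=
      mul_le_mul_of_nonneg_right hlt.le hx0
    have hq : 0 ≤ αs * (1 - p) * powDefect p i :=
      mul_nonneg (mul_nonneg hs0.le (by linarith)) hx0
    have hlog := log_one_sub_add_le (u := αt * powDefect p i) (v := αs * powDefect p i)
      (by positivity) (by nlinarith) (by nlinarith)
    have : Real.log (1 - αs * powDefect p i) + αs * (1 - p) * powDefect p i
        ≤ Real.log (1 - αt * powDefect p i) := by nlinarith
    rw [← mul_div_assoc, ← add_div]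
    exact div_le_div_of_nonneg_right this (by positivity)
  have hpartial : ∀ n : ℕ, Real.log p
      + αs * (1 - p) * ((1 - p) - (1 - p ^ (n + 1)) / ((n : ℝ) + 1))
      ≤ ∑ i ∈ Finset.range n, T i := by
    intro n
    have h := Finset.sum_le_sum fun i (_ : i ∈ Finset.range n) => hterm i
    rw [Finset.sum_add_distrib, ← Finset.mul_sum, sum_powDefect_div] at h
    linarith [log_le_sum_log ⟨hp0, hp1⟩ hs0 hs1 hαs_eq n]
  have hTnonpos : ∀ i, T i ≤ 0 := fun i =>
    div_nonpos_of_nonpos_of_nonneg (Real.log_nonpos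
      (by nlinarith [powDefect_le_one hp0.le hp1.le i])
      (by nlinarith [powDefect_nonneg hp0.le i])) (by positivity)
  have hsummable : Summable T := by
    refine summable_neg_iff.1 (summable_of_sum_range_le (c := -Real.log p)
      (fun i => neg_nonneg.2 (hTnonpos i)) fun n => ?_)
    have hnn : 0 ≤ ∑ i ∈ Finset.range n, powDefect p i / (((i : ℝ) + 1) * ((i : ℝ) + 2)) :=
      Finset.sum_nonneg fun i _ => div_nonneg (powDefect_nonneg hp0.le i) (by positivity)
    rw [sum_powDefect_div] at hnn
    have hnn' := mul_nonneg (mul_nonneg hs0.le (sub_nonneg.2 hp1.le)) hnn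
    rw [Finset.sum_neg_distrib]
    linarith [hpartial n]
  have hdecay : Filter.Tendsto (fun n : ℕ => (1 - p ^ (n + 1)) / ((n : ℝ) + 1))
      Filter.atTop (nhds 0) := by
    refine squeeze_zero (fun n => div_nonneg
      (sub_nonneg.2 (pow_le_one₀ hp0.le hp1.le)) (by positivity)) (fun n => ?_)
      (tendsto_one_div_add_atTop_nhds_zero_nat (𝕜 := ℝ))
    exact div_le_div_of_nonneg_right (by linarith [pow_pos hp0 (n + 1)]) (by positivity)
  have hlim := (((hdecay.const_sub (1 - p)).const_mul (αs * (1 - p))).const_add (Real.log p))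
  have hge := le_of_tendsto_of_tendsto' hlim hsummable.hasSum.tendsto_sum_nat hpartial
  rw [← hrhs, ← hαt_eq] at hge
  have hstrict : αt * (1 - p) ^ 2 / p < αs * (1 - p) ^ 2 := by
    rw [div_lt_iff₀ hp0]
    have : 0 < (1 - p) ^ 2 := pow_pos (by linarith) 2
    nlinarith
  nlinarith
end

section
/- Let N, h, k be integers with p := h/N ∈ (0,1), N ≥ 1/(1−p) + 1, and 1 ≤ k ≤ h+1. Then 1 ≤ (∑_{j=1}^k (N−h)/(N−j+1) · ∏_{s=0}^{j−2} (h−s)/(N−s)) / (1 − p^k) ≤ 1 + e/((1−p)(N−1)). -/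
/-- Telescoping of the rank probabilities. -/
theorem sum_rank_eq_one_sub_prod (N h k : ℕ) (hhN : h < N) (hk : k ≤ h + 1) :
    (∑ j ∈ Finset.Icc 1 k, ((N : ℝ) - h) / ((N : ℝ) - j + 1) *
      ∏ s ∈ Finset.range (j - 1), (((h : ℝ) - s) / ((N : ℝ) - s))) =
      1 - ∏ s ∈ Finset.range k, (((h : ℝ) - s) / ((N : ℝ) - s)) := by
  induction k with
  | zero => simp
  | succ k ih =>
    rw [Finset.sum_Icc_succ_top (by omega), ih (by omega), Finset.prod_range_succ,
      Nat.add_sub_cancel]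
    have hkN : (k : ℝ) < N := by exact_mod_cast (by omega : k < N)
    have hpos : (N : ℝ) - k ≠ 0 := by linarith
    have hden : (N : ℝ) - (k + 1 : ℕ) + 1 = N - k := by push_cast; ring
    rw [hden]
    field_simp
    ring

theorem prod_falling_ratio_le_pow (N h k : ℕ) (hhN : h < N) (hk : k ≤ h + 1) :
    ∏ s ∈ Finset.range k, (((h : ℝ) - s) / ((N : ℝ) - s)) ≤ ((h : ℝ) / N) ^ k := by
  have h2 : (h : ℝ) < N := by exact_mod_cast hhN
  have h0 : (0 : ℝ) ≤ h := Nat.cast_nonneg h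
  have hbound : ∀ s ∈ Finset.range k, ((h : ℝ) - s) / ((N : ℝ) - s) ≤ (h : ℝ) / N := by
    intro s hs
    have hs' := Finset.mem_range.mp hs
    have h1 : (s : ℝ) ≤ h := by exact_mod_cast (by omega : s ≤ h)
    have h3 : (0 : ℝ) ≤ s := Nat.cast_nonneg s
    rw [div_le_div_iff₀ (by linarith) (by linarith)]
    nlinarith
  calc _ ≤ ∏ s ∈ Finset.range k, ((h : ℝ) / N) := by
        refine Finset.prod_le_prod (fun s hs => ?_) hbound
        have hs' := Finset.mem_range.mp hs
        have h1 : (s : ℝ) ≤ h := by exact_mod_cast (by omega : s ≤ h)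
        exact div_nonneg (by linarith) (by linarith)
    _ = _ := by rw [Finset.prod_const, Finset.card_range]

/-- A sharper geometric bound, obtained by shifting the denominators by one. -/
theorem prod_falling_ratio_mul_le (N h k : ℕ) (hhN : h + 1 < N) (hk : k ≤ h) :
    (∏ s ∈ Finset.range k, (((h : ℝ) - s) / ((N : ℝ) - s))) * N ≤
      ((h : ℝ) / (N - 1)) ^ k * (N - k) := by
  have hN : (h : ℝ) + 1 < N := by exact_mod_cast hhN
  have h0 : (0 : ℝ) ≤ h := Nat.cast_nonneg h
  induction k with
  | zero => simp
  | succ k ih =>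
    have hk' : (k : ℝ) + 1 ≤ h := by exact_mod_cast hk
    have hk0 : (0 : ℝ) ≤ k := Nat.cast_nonneg k
    have hpos : (0 : ℝ) < N - k := by linarith
    have hq : (0 : ℝ) ≤ (h : ℝ) / (N - 1) := div_nonneg h0 (by linarith)
    have hstep : (h : ℝ) - k ≤ (h : ℝ) / (N - 1) * (N - (k + 1)) := by
      rw [div_mul_eq_mul_div, le_div_iff₀ (by linarith)]
      nlinarith
    rw [Finset.prod_range_succ]
    push_cast
    calc _ = (∏ s ∈ Finset.range k, (((h : ℝ) - s) / ((N : ℝ) - s))) * N *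
          (((h : ℝ) - k) / (N - k)) := by ring
      _ ≤ ((h : ℝ) / (N - 1)) ^ k * (N - k) * (((h : ℝ) - k) / (N - k)) :=
          mul_le_mul_of_nonneg_right (ih (by omega)) (div_nonneg (by linarith) hpos.le)
      _ = ((h : ℝ) / (N - 1)) ^ k * (h - k) := by field_simp
      _ ≤ ((h : ℝ) / (N - 1)) ^ k * ((h : ℝ) / (N - 1) * (N - (k + 1))) :=
          mul_le_mul_of_nonneg_left hstep (pow_nonneg hq k)
      _ = _ := by ring

theorem nat_mul_one_sub_mul_pow_le_one (k : ℕ) {q : ℝ} (h0 : 0 ≤ q) (h1 : q ≤ 1) :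
    k * (1 - q) * q ^ k ≤ 1 := by
  have hb : 1 + (k : ℝ) * (1 - q) ≤ (1 + (1 - q)) ^ k :=
    one_add_mul_le_pow (by linarith) k
  have hp : (q * (1 + (1 - q))) ^ k ≤ 1 :=
    pow_le_one₀ (by nlinarith) (by nlinarith [sq_nonneg (1 - q)])
  rw [mul_pow] at hp
  nlinarith [pow_nonneg h0 k, mul_le_mul_of_nonneg_left hb (pow_nonneg h0 k)]

theorem prod_falling_ratio_increment_le (N h k : ℕ) (hhN : h + 1 < N) (hk : k ≤ h) :
    (∏ s ∈ Finset.range k, (((h : ℝ) - s) / ((N : ℝ) - s))) *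
      ((h : ℝ) / N - ((h : ℝ) - k) / (N - k)) ≤ 2 / ((N : ℝ) - 1) := by
  have hN : (h : ℝ) + 2 ≤ N := by exact_mod_cast hhN
  have h0 : (0 : ℝ) ≤ h := Nat.cast_nonneg h
  have hk0 : (0 : ℝ) ≤ k := Nat.cast_nonneg k
  have hk' : (k : ℝ) ≤ h := by exact_mod_cast hk
  have hNpos : (0 : ℝ) < N := by linarith
  have hN1 : (0 : ℝ) < (N : ℝ) - 1 := by linarith
  have hNk : (0 : ℝ) < (N : ℝ) - k := by linarith
  have hmul := prod_falling_ratio_mul_le N h k hhN hk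
  have hpow := nat_mul_one_sub_mul_pow_le_one k (q := (h : ℝ) / (N - 1))
    (div_nonneg h0 hN1.le) ((div_le_one hN1).mpr (by linarith))
  set P := ∏ s ∈ Finset.range k, (((h : ℝ) - s) / ((N : ℝ) - s))
  set Q := ((h : ℝ) / (N - 1)) ^ k
  have hQ : 0 ≤ Q := pow_nonneg (div_nonneg h0 hN1.le) k
  have hkQ : (k : ℝ) * Q * (N - 1 - h) ≤ N - 1 := by
    have e : (k : ℝ) * (1 - h / (N - 1)) * Q = k * Q * (N - 1 - h) / (N - 1) := by
      field_simp
    rwa [e, div_le_one hN1] at hpow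
  have hkQ2 : (k : ℝ) * Q * (N - h) ≤ 2 * (N - 1) := by
    nlinarith [mul_nonneg (mul_nonneg hk0 hQ) (by linarith : (0 : ℝ) ≤ N - h - 2)]
  calc P * ((h : ℝ) / N - ((h : ℝ) - k) / (N - k))
      = P * N * (k * (N - h) / (N ^ 2 * (N - k))) := by field_simp; ring
    _ ≤ Q * (N - k) * (k * (N - h) / (N ^ 2 * (N - k))) :=
        mul_le_mul_of_nonneg_right hmul
          (div_nonneg (mul_nonneg hk0 (by linarith)) (by positivity))
    _ = k * Q * (N - h) / N ^ 2 := by field_simp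
    _ ≤ 2 * (N - 1) / N ^ 2 := by gcongr
    _ ≤ 2 / ((N : ℝ) - 1) := by
        rw [div_le_div_iff₀ (by positivity) hN1]
        nlinarith

theorem pow_sub_prod_falling_ratio_le (N h k : ℕ) (hhN : h + 1 < N) (hk : k ≤ h + 1) :
    ((h : ℝ) / N) ^ k - ∏ s ∈ Finset.range k, (((h : ℝ) - s) / ((N : ℝ) - s)) ≤
      2 / ((N : ℝ) - 1) * ∑ i ∈ Finset.range k, ((h : ℝ) / N) ^ i := by
  induction k with
  | zero => simp
  | succ k ih =>
    have hinc := prod_falling_ratio_increment_le N h k hhN (by omega)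
    have hp : (0 : ℝ) ≤ (h : ℝ) / N := by positivity
    have hih := mul_le_mul_of_nonneg_left (ih (by omega)) hp
    rw [Finset.prod_range_succ, geom_sum_succ, pow_succ]
    linarith


theorem stmt16 (N h k : ℕ) (hh : 0 < h) (hhN : h < N)
    (hN : (1 : ℝ) / (1 - (h : ℝ) / N) + 1 ≤ N)
    (hk1 : 1 ≤ k) (hk2 : k ≤ h + 1) :
    1 ≤ (∑ j ∈ Finset.Icc 1 k, ((N : ℝ) - h) / ((N : ℝ) - j + 1) *
            ∏ s ∈ Finset.range (j - 1), (((h : ℝ) - s) / ((N : ℝ) - s))) /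
          (1 - ((h : ℝ) / N) ^ k) ∧
    (∑ j ∈ Finset.Icc 1 k, ((N : ℝ) - h) / ((N : ℝ) - j + 1) *
            ∏ s ∈ Finset.range (j - 1), (((h : ℝ) - s) / ((N : ℝ) - s))) /
          (1 - ((h : ℝ) / N) ^ k)
      ≤ 1 + Real.exp 1 / ((1 - (h : ℝ) / N) * ((N : ℝ) - 1)) := by
  have hhN' : (h : ℝ) < N := by exact_mod_cast hhN
  have h0 : (0 : ℝ) < h := by exact_mod_cast hh
  have hNpos : (0 : ℝ) < N := by linarith
  have hp0 : (0 : ℝ) ≤ (h : ℝ) / N := by positivity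
  have hp1 : (h : ℝ) / N < 1 := (div_lt_one hNpos).mpr hhN'
  have hq : (0 : ℝ) < 1 - (h : ℝ) / N := by linarith
  have hgap : h + 1 < N := by
    by_contra hcon
    have hNh : (N : ℝ) = h + 1 := by exact_mod_cast (by omega : N = h + 1)
    have e : (1 : ℝ) / (1 - (h : ℝ) / N) = N := by
      rw [hNh]
      field_simp
      ring
    linarith
  have hgap' : (h : ℝ) + 1 < N := by exact_mod_cast hgap
  have hN1 : (0 : ℝ) < (N : ℝ) - 1 := by linarith
  have hden : 0 < 1 - ((h : ℝ) / N) ^ k := by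
    have := pow_lt_one₀ hp0 hp1 (by omega : k ≠ 0)
    linarith
  rw [sum_rank_eq_one_sub_prod N h k hhN hk2]
  constructor
  · rw [one_le_div hden]
    linarith [prod_falling_ratio_le_pow N h k hhN hk2]
  · rw [div_le_iff₀ hden]
    have hdiff := pow_sub_prod_falling_ratio_le N h k hgap hk2
    have hgeom : (∑ i ∈ Finset.range k, ((h : ℝ) / N) ^ i) * (1 - (h : ℝ) / N) =
        1 - ((h : ℝ) / N) ^ k := geom_sum_mul_neg _ _
    have hS : 0 ≤ ∑ i ∈ Finset.range k, ((h : ℝ) / N) ^ i :=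
      Finset.sum_nonneg fun i _ => pow_nonneg hp0 i
    have he : (2 : ℝ) ≤ Real.exp 1 := by linarith [Real.add_one_le_exp (1 : ℝ)]
    have hmono : 2 / ((N : ℝ) - 1) * ∑ i ∈ Finset.range k, ((h : ℝ) / N) ^ i ≤
        Real.exp 1 / ((N : ℝ) - 1) * ∑ i ∈ Finset.range k, ((h : ℝ) / N) ^ i := by
      gcongr
    have hrewrite : Real.exp 1 / ((1 - (h : ℝ) / N) * ((N : ℝ) - 1)) *
        (1 - ((h : ℝ) / N) ^ k) =
        Real.exp 1 / ((N : ℝ) - 1) * ∑ i ∈ Finset.range k, ((h : ℝ) / N) ^ i := by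
      rw [← hgeom]
      generalize (1 - (h : ℝ) / N) = r at hq ⊢
      field_simp
    rw [add_mul, one_mul, hrewrite]
    linarith
end

section
/- Let p ∈ (0,1) and let N, i, j, ℓ be positive integers with N ≥ 32, (√N · log₂N)/(1−p) ≤ i ≤ N − (√N · log₂N)/(1−p), j ≤ (log₂N)/(1−p), and ℓ ≤ j, and let t ∈ [(i−1)/N, i/N]. Then 1 − 3·log₂N/((1−p)√N) ≤ ((i/N) · C(j−1,ℓ−1)·C(N−j,i−ℓ)/C(N−1,i−1)) / (C(j−1,ℓ−1)·(1−t)^{j−ℓ}·t^ℓ) ≤ 1 + 5·log₂N/((1−p)√N). -/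
theorem Nat.descFactorial_mul_pow_le {x M : ℕ} (hxM : x ≤ M) (k : ℕ) :
    x.descFactorial k * M ^ k ≤ x ^ k * M.descFactorial k := by
  induction k with
  | zero => simp
  | succ k ih =>
    have h : (x - k) * M ≤ x * (M - k) := by
      rw [Nat.sub_mul, Nat.mul_sub]
      exact Nat.sub_le_sub_left (by rw [mul_comm x k]; gcongr) _
    calc x.descFactorial (k + 1) * M ^ (k + 1)
        = ((x - k) * M) * (x.descFactorial k * M ^ k) := by
          rw [Nat.descFactorial_succ]; ring
      _ ≤ (x * (M - k)) * (x ^ k * M.descFactorial k) := Nat.mul_le_mul h ih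
      _ = x ^ (k + 1) * M.descFactorial (k + 1) := by
          rw [Nat.descFactorial_succ]; ring

/-- Bernoulli lower bound for a ratio of falling factorials against a power. -/
theorem one_sub_sq_div_le_descFactorial_ratio {x M k : ℕ} {τ N : ℝ} (hkx : k ≤ x) (hkM : k ≤ M)
    (hN : 0 < N) (hMN : (M : ℝ) ≤ N) (hτ : 0 < τ) (hτx : τ ≤ (x + 1) / N) :
    1 - (k : ℝ) ^ 2 / (x + 1) ≤ x.descFactorial k / (M.descFactorial k * τ ^ k) := by
  have hx : (0 : ℝ) < x + 1 := by positivity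
  have hkx' : (k : ℝ) ≤ x := by exact_mod_cast hkx
  have hM : (0 : ℝ) < M.descFactorial k := by exact_mod_cast Nat.descFactorial_pos.2 hkM
  have hden : (M.descFactorial k : ℝ) * τ ^ k ≤ ((x : ℝ) + 1) ^ k := by
    calc (M.descFactorial k : ℝ) * τ ^ k ≤ N ^ k * ((x + 1) / N) ^ k := by
          gcongr
          calc (M.descFactorial k : ℝ) ≤ (M : ℝ) ^ k := by
                exact_mod_cast Nat.descFactorial_le_pow M k
            _ ≤ N ^ k := by gcongr
      _ = ((x : ℝ) + 1) ^ k := by rw [← mul_pow, mul_div_cancel₀ _ hN.ne']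
  have hnum : ((x : ℝ) + 1 - k) ^ k ≤ x.descFactorial k := by
    have h := Nat.pow_sub_le_descFactorial x k
    have h' : (((x + 1 - k : ℕ) : ℝ)) ^ k ≤ x.descFactorial k := by exact_mod_cast h
    rwa [Nat.cast_sub (by omega), Nat.cast_add, Nat.cast_one] at h'
  have hle : (k : ℝ) / (x + 1) ≤ 1 := by rw [div_le_one hx]; linarith
  calc 1 - (k : ℝ) ^ 2 / (x + 1) = 1 + k * (-(k / (x + 1))) := by ring
    _ ≤ (1 + -(k / (x + 1))) ^ k := one_add_mul_le_pow (by linarith) k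
    _ = ((x : ℝ) + 1 - k) ^ k / (x + 1) ^ k := by
        rw [← div_pow]; congr 1; field_simp; ring
    _ ≤ x.descFactorial k / (M.descFactorial k * τ ^ k) := by gcongr

/-- Bernoulli upper bound for a ratio of falling factorials against a power. -/
theorem descFactorial_ratio_mul_le_one {x M k : ℕ} {τ δ : ℝ} (hx : 0 < x) (hxM : x ≤ M)
    (hkM : k ≤ M) (hτ : 0 < τ) (hδ : δ ≤ 1) (h : (x : ℝ) * (1 - δ) ≤ M * τ) :
    (x.descFactorial k : ℝ) / (M.descFactorial k * τ ^ k) * (1 - k * δ) ≤ 1 := by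
  have hx' : (0 : ℝ) < x := by exact_mod_cast hx
  have hM : (0 : ℝ) < M.descFactorial k := by exact_mod_cast Nat.descFactorial_pos.2 hkM
  have hM' : (0 : ℝ) < (M : ℝ) ^ k := by
    have : 0 < M := by omega
    positivity
  have hB : 1 - k * δ ≤ (1 - δ) ^ k := by
    have := one_add_mul_le_pow (a := -δ) (by linarith) k
    simpa [sub_eq_add_neg] using this
  have hpow : (x : ℝ) ^ k * (1 - δ) ^ k ≤ M ^ k * τ ^ k := by
    rw [← mul_pow, ← mul_pow]
    exact pow_le_pow_left₀ (mul_nonneg hx'.le (by linarith)) h k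
  have hD : (x.descFactorial k : ℝ) * M ^ k ≤ x ^ k * M.descFactorial k := by
    exact_mod_cast Nat.descFactorial_mul_pow_le hxM k
  rw [div_mul_eq_mul_div, div_le_one (by positivity)]
  calc (x.descFactorial k : ℝ) * (1 - k * δ) ≤ x.descFactorial k * (1 - δ) ^ k := by gcongr
    _ ≤ M.descFactorial k * τ ^ k := by
        refine le_of_mul_le_mul_right ?_ hM'
        calc (x.descFactorial k : ℝ) * (1 - δ) ^ k * M ^ k
            = x.descFactorial k * M ^ k * (1 - δ) ^ k := by ring
          _ ≤ x ^ k * M.descFactorial k * (1 - δ) ^ k :=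
              mul_le_mul_of_nonneg_right hD (pow_nonneg (by linarith) k)
          _ = M.descFactorial k * (x ^ k * (1 - δ) ^ k) := by ring
          _ ≤ M.descFactorial k * (M ^ k * τ ^ k) := by gcongr
          _ = M.descFactorial k * τ ^ k * M ^ k := by ring

/-- The hypergeometric weight as a product of falling factorials. -/
theorem choose_ratio_eq_descFactorial {a b l m : ℕ} (hl : 1 ≤ l) :
    ((a + l : ℕ) : ℝ) / ((a + l + (b + m) : ℕ) : ℝ) *
      (((a + b).choose a : ℝ) / ((a + l + (b + m) - 1).choose (a + l - 1) : ℝ)) =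
    ((a + l).descFactorial l : ℝ) / ((a + l + (b + m)).descFactorial l : ℝ) *
      (((b + m).descFactorial m : ℝ) / ((a + (b + m)).descFactorial m : ℝ)) := by
  have h1 := Nat.factorial_mul_descFactorial (n := a + l) (k := l) (by omega)
  have h2 := Nat.factorial_mul_descFactorial (n := a + l + (b + m)) (k := l) (by omega)
  have h3 := Nat.factorial_mul_descFactorial (n := b + m) (k := m) (by omega)
  have h4 := Nat.factorial_mul_descFactorial (n := a + (b + m)) (k := m) (by omega)
  rw [show a + l - l = a by omega] at h1
  rw [show a + l + (b + m) - l = a + (b + m) by omega] at h2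
  rw [show b + m - m = b by omega] at h3
  rw [show a + (b + m) - m = a + b by omega] at h4
  have h5 := Nat.add_choose_mul_factorial_mul_factorial a b
  have h6 := Nat.add_choose_mul_factorial_mul_factorial (a + l) (b + m)
  rw [← Nat.choose_symm_add] at h5 h6
  have h7 := Nat.add_one_mul_choose_eq (a + l + (b + m) - 1) (a + l - 1)
  rw [show a + l + (b + m) - 1 + 1 = a + l + (b + m) by omega,
    show a + l - 1 + 1 = a + l by omega] at h7
  have p1 : 0 < (a + l + (b + m) - 1).choose (a + l - 1) := Nat.choose_pos (by omega)
  have p2 : 0 < (a + l + (b + m)).descFactorial l := Nat.descFactorial_pos.2 (by omega)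
  have p3 : 0 < (a + (b + m)).descFactorial m := Nat.descFactorial_pos.2 (by omega)
  have p5 : 0 < a + l + (b + m) := by omega
  have fa := Nat.factorial_pos a
  have fb := Nat.factorial_pos b
  have key : (a + b).choose a * ((a + l + (b + m)).descFactorial l *
      (a + (b + m)).descFactorial m) =
      (a + l).descFactorial l * (b + m).descFactorial m * (a + l + (b + m)).choose (a + l) := by
    refine Nat.eq_of_mul_eq_mul_left (Nat.mul_pos fa fb) ?_
    calc _ = ((a + b).choose a * a.factorial * b.factorial) *
          (a + (b + m)).descFactorial m * (a + l + (b + m)).descFactorial l := by ring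
      _ = (a + l + (b + m)).factorial := by rw [h5, h4, h2]
      _ = (a + l + (b + m)).choose (a + l) * (a.factorial * (a + l).descFactorial l) *
          (b.factorial * (b + m).descFactorial m) := by rw [h1, h3, h6]
      _ = _ := by ring
  generalize (a + l + (b + m) - 1).choose (a + l - 1) = c at *
  rw [div_mul_div_comm, div_mul_div_comm, div_eq_div_iff (by positivity) (by positivity)]
  norm_cast
  rw [h7]
  calc _ = (a + l) * ((a + b).choose a * ((a + l + (b + m)).descFactorial l *
      (a + (b + m)).descFactorial m)) := by ring
    _ = _ := by rw [key]; ring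

theorem stmt17 (p : ℝ) (hp : p ∈ Set.Ioo (0 : ℝ) 1) (N i j ℓ : ℕ)
    (hN : 32 ≤ N) (hi1 : 1 ≤ i) (hj1 : 1 ≤ j) (hℓ1 : 1 ≤ ℓ)
    (hi_lo : Real.sqrt N * Real.logb 2 N / (1 - p) ≤ (i : ℝ))
    (hi_hi : (i : ℝ) ≤ (N : ℝ) - Real.sqrt N * Real.logb 2 N / (1 - p))
    (hj : (j : ℝ) ≤ Real.logb 2 N / (1 - p))
    (hℓj : ℓ ≤ j)
    (t : ℝ) (ht : t ∈ Set.Icc (((i : ℝ) - 1) / N) ((i : ℝ) / N)) :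
    1 - 3 * Real.logb 2 N / ((1 - p) * Real.sqrt N) ≤
      ((i : ℝ) / N * ((Nat.choose (j - 1) (ℓ - 1) : ℝ) * (Nat.choose (N - j) (i - ℓ) : ℝ) /
            (Nat.choose (N - 1) (i - 1) : ℝ))) /
        ((Nat.choose (j - 1) (ℓ - 1) : ℝ) * (1 - t) ^ (j - ℓ) * t ^ ℓ) ∧
    ((i : ℝ) / N * ((Nat.choose (j - 1) (ℓ - 1) : ℝ) * (Nat.choose (N - j) (i - ℓ) : ℝ) /
            (Nat.choose (N - 1) (i - 1) : ℝ))) /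
        ((Nat.choose (j - 1) (ℓ - 1) : ℝ) * (1 - t) ^ (j - ℓ) * t ^ ℓ)
      ≤ 1 + 5 * Real.logb 2 N / ((1 - p) * Real.sqrt N) := by
  obtain ⟨hp0, hp1⟩ := hp
  obtain ⟨ht1, ht2⟩ := ht
  have hq : 0 < 1 - p := by linarith
  have hNpos : (0 : ℝ) < N := by exact_mod_cast (by omega : 0 < N)
  set s := Real.sqrt N
  have hss : s * s = N := Real.mul_self_sqrt hNpos.le
  have hs0 : 0 < s := Real.sqrt_pos.2 hNpos
  have hlog : 2 ≤ Real.logb 2 N := by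
    rw [Real.le_logb_iff_rpow_le (by norm_num) hNpos]
    have : (32 : ℝ) ≤ N := by exact_mod_cast hN
    norm_num
    linarith
  obtain ⟨L, hL⟩ : ∃ L, L = Real.logb 2 N / (1 - p) := ⟨_, rfl⟩
  have hL2 : 2 ≤ L := by
    rw [hL, le_div_iff₀ hq]; nlinarith
  rw [mul_div_assoc, ← hL] at hi_lo hi_hi
  rw [← hL] at hj
  have e3 : 3 * Real.logb 2 N / ((1 - p) * s) = 3 * (L / s) := by rw [hL]; field_simp
  have e5 : 5 * Real.logb 2 N / ((1 - p) * s) = 5 * (L / s) := by rw [hL]; field_simp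
  rw [e3, e5]
  have h2L : 2 * L ≤ s := by
    refine le_of_mul_le_mul_left ?_ hs0
    linarith
  have hℓL : (ℓ : ℝ) ≤ L := le_trans (by exact_mod_cast hℓj) hj
  obtain ⟨m, rfl⟩ := Nat.exists_eq_add_of_le hℓj
  have hmj : (ℓ : ℝ) + m ≤ L := by exact_mod_cast hj
  have hmL : (m : ℝ) ≤ L := by linarith [Nat.cast_nonneg (α := ℝ) ℓ]
  have hLi : L ≤ i := by nlinarith
  have hℓi : ℓ ≤ i := by exact_mod_cast hℓL.trans hLi
  have hLNi : L ≤ (N : ℝ) - i := by nlinarith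
  have hmN : i + m ≤ N := by
    have : (i : ℝ) + m ≤ N := by linarith
    exact_mod_cast this
  obtain ⟨a, rfl⟩ := Nat.exists_eq_add_of_le' hℓi
  obtain ⟨b, hb⟩ := Nat.exists_eq_add_of_le hmN
  obtain rfl : N = a + ℓ + (b + m) := by omega
  rw [show a + ℓ + (b + m) - (ℓ + m) = a + b by omega, show a + ℓ - ℓ = a by omega,
    show ℓ + m - ℓ = m by omega]
  have hc : (0 : ℝ) < ((ℓ + m - 1).choose (ℓ - 1) : ℝ) := by
    exact_mod_cast Nat.choose_pos (by omega)
  have hid := choose_ratio_eq_descFactorial (a := a) (b := b) (m := m) hℓ1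
  have hi0 : (0 : ℝ) < ((a + ℓ : ℕ) : ℝ) := by exact_mod_cast hi1
  have hn : (((b + m : ℕ)) : ℝ) = ((a + ℓ + (b + m) : ℕ) : ℝ) - ((a + ℓ : ℕ) : ℝ) := by
    push_cast; ring
  have hM : (((a + (b + m) : ℕ)) : ℝ) = ((a + ℓ + (b + m) : ℕ) : ℝ) - (ℓ : ℝ) := by
    push_cast; ring
  have hn0 : (0 : ℝ) < ((b + m : ℕ) : ℝ) := by rw [hn]; linarith
  generalize hNr : ((a + ℓ + (b + m) : ℕ) : ℝ) = Nr at *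
  generalize hir : ((a + ℓ : ℕ) : ℝ) = ir at *
  have hi2 : 2 ≤ ir := by linarith
  have ht0 : 0 < t := lt_of_lt_of_le (div_pos (by linarith) hNpos) ht1
  have ht1' : (ir - 1) ≤ Nr * t := by rwa [div_le_iff₀' hNpos] at ht1
  have ht2' : Nr * t ≤ ir := by rwa [le_div_iff₀' hNpos] at ht2
  have ht3 : 0 < 1 - t := by
    have : 0 < Nr * (1 - t) := by linarith
    exact pos_of_mul_pos_right this hNpos.le
  have lo1 := one_sub_sq_div_le_descFactorial_ratio (x := a + ℓ) (M := a + ℓ + (b + m)) (k := ℓ)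
    (τ := t) (N := Nr) (by omega) (by omega) hNpos hNr.le ht0
    (by rw [hir, le_div_iff₀' hNpos]; linarith)
  have lo2 := one_sub_sq_div_le_descFactorial_ratio (x := b + m) (M := a + (b + m)) (k := m)
    (τ := 1 - t) (N := Nr) (by omega) (by omega) hNpos
    (by rw [hM]; linarith [Nat.cast_nonneg (α := ℝ) ℓ]) ht3
    (by rw [hn, le_div_iff₀' hNpos]; linarith)
  have up1 := descFactorial_ratio_mul_le_one (x := a + ℓ) (M := a + ℓ + (b + m)) (k := ℓ)
    (τ := t) (δ := 1 / ir) hi1 (by omega) (by omega) ht0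
    (by rw [div_le_one hi0]; linarith)
    (by rw [hir, hNr, mul_sub, mul_one_div_cancel hi0.ne']; linarith)
  have up2 := descFactorial_ratio_mul_le_one (x := b + m) (M := a + (b + m)) (k := m)
    (τ := 1 - t) (δ := ℓ / Nr) (by exact_mod_cast hn0) (by omega) (by omega) ht3
    (by rw [div_le_one hNpos]; linarith)
    (by
      have h : ((b + m : ℕ) : ℝ) ≤ Nr * (1 - t) := by rw [hn]; linarith
      calc ((b + m : ℕ) : ℝ) * (1 - ℓ / Nr) = ((b + m : ℕ) : ℝ) / Nr * (a + (b + m) : ℕ) := by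
            rw [hM]; field_simp
        _ ≤ (1 - t) * (a + (b + m) : ℕ) := by
            gcongr
            rwa [div_le_iff₀' hNpos]
        _ = _ := mul_comm _ _)
  have hR : ir / Nr * (((ℓ + m - 1).choose (ℓ - 1) : ℝ) * ((a + b).choose a : ℝ) /
        ((a + ℓ + (b + m) - 1).choose (a + ℓ - 1) : ℝ)) /
        (((ℓ + m - 1).choose (ℓ - 1) : ℝ) * (1 - t) ^ m * t ^ ℓ) =
      ((a + ℓ).descFactorial ℓ : ℝ) / ((a + ℓ + (b + m)).descFactorial ℓ * t ^ ℓ) *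
      (((b + m).descFactorial m : ℝ) / ((a + (b + m)).descFactorial m * (1 - t) ^ m)) := by
    calc _ = ir / Nr * (((a + b).choose a : ℝ) /
          ((a + ℓ + (b + m) - 1).choose (a + ℓ - 1) : ℝ)) / ((1 - t) ^ m * t ^ ℓ) := by
          rw [mul_div_assoc ((ℓ + m - 1).choose (ℓ - 1) : ℝ), mul_left_comm,
            mul_assoc ((ℓ + m - 1).choose (ℓ - 1) : ℝ), mul_div_mul_left _ _ hc.ne']
      _ = _ := by
          rw [hid, div_mul_div_comm, div_mul_div_comm, div_div]
          congr 1
          ring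
  rw [hR]
  have P1 : 0 ≤ ((a + ℓ).descFactorial ℓ : ℝ) /
    ((a + ℓ + (b + m)).descFactorial ℓ * t ^ ℓ) := by positivity
  have P2 : 0 ≤ ((b + m).descFactorial m : ℝ) /
    ((a + (b + m)).descFactorial m * (1 - t) ^ m) := by positivity
  generalize ((a + ℓ).descFactorial ℓ : ℝ) /
    ((a + ℓ + (b + m)).descFactorial ℓ * t ^ ℓ) = A at *
  generalize ((b + m).descFactorial m : ℝ) /
    ((a + (b + m)).descFactorial m * (1 - t) ^ m) = B at *
  have hl0 : (0 : ℝ) ≤ ℓ := Nat.cast_nonneg _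
  have hm0 : (0 : ℝ) ≤ m := Nat.cast_nonneg _
  have hx0 : 0 ≤ L / s := by positivity
  have hsL : 0 < s * L := by positivity
  have hx2 : L / s ≤ 1 / 2 := by rw [div_le_iff₀ hs0]; linarith
  have sq_bound {k d : ℝ} (hk0 : 0 ≤ k) (hk : k ≤ L) (hd : s * L ≤ d) :
      k ^ 2 / (d + 1) ≤ L / s := by
    rw [div_le_div_iff₀ (by linarith) hs0]
    calc k ^ 2 * s ≤ L ^ 2 * s := by gcongr
      _ = L * (s * L) := by ring
      _ ≤ L * (d + 1) := by gcongr; linarith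
  constructor
  · have b1 := sq_bound hl0 hℓL hi_lo
    have b2 := sq_bound hm0 hmL (by linarith : s * L ≤ ((b + m : ℕ) : ℝ))
    rw [hir] at lo1
    have hprod : (1 - L / s) * (1 - L / s) ≤ A * B :=
      mul_le_mul (by linarith) (by linarith) (by linarith) P1
    have hsq : 0 ≤ (L / s) * (L / s) := mul_nonneg hx0 hx0
    linarith
  · have b1 : (ℓ : ℝ) * (1 / ir) ≤ L / s / 2 := by
      rw [mul_one_div, div_div, div_le_div_iff₀ hi0 (by positivity)]
      calc (ℓ : ℝ) * (s * 2) ≤ L * (s * 2) := by gcongr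
        _ = 2 * (s * L) := by ring
        _ ≤ L * ir := by gcongr
    have b2 : (m : ℝ) * (ℓ / Nr) ≤ L / s / 2 := by
      rw [← hss, ← mul_div_assoc, div_div, div_le_div_iff₀ (by positivity) (by positivity)]
      calc (m : ℝ) * ℓ * (s * 2) ≤ L * L * (s * 2) := by gcongr
        _ = L * (s * (2 * L)) := by ring
        _ ≤ L * (s * s) := by gcongr
    generalize L / s = y at *
    have hA : A * (1 - y / 2) ≤ 1 :=
      (mul_le_mul_of_nonneg_left (by linarith) P1).trans up1
    have hB : B * (1 - y / 2) ≤ 1 :=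
      (mul_le_mul_of_nonneg_left (by linarith) P2).trans up2
    have hpos : 0 < (1 - y / 2) ^ 2 := pow_pos (by linarith) 2
    have hAB : A * B * (1 - y / 2) ^ 2 ≤ 1 := by
      have := mul_le_one₀ hA (mul_nonneg P2 (by linarith)) hB
      linarith
    refine le_of_mul_le_mul_right (hAB.trans ?_) hpos
    clear * - hx0 hx2
    nlinarith [mul_nonneg hx0 (by linarith : 0 ≤ 1 / 2 - y), pow_nonneg hx0 3]
end

section
/- For every p ∈ (0,1), the series ∑_{i=1}^∞ ln(p^i · (1 + i(1−p))) / (i(i+1)) diverges to −∞; equivalently, its partial sums tend to −∞. -/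
/-- The tangent line inequality for the logarithm at the point `c⁻¹`. -/
lemma log_le_mul_sub_one_sub_log {c x : ℝ} (hc : 0 < c) (hx : 0 < x) :
    Real.log x ≤ c * x - 1 - Real.log c := by
  have h := Real.log_le_sub_one_of_pos (mul_pos hc hx)
  rw [Real.log_mul hc.ne' hx.ne'] at h
  linarith

/-- A linear upper bound, of negative slope, for `log (p ^ i * (1 + i * (1 - p)))`. -/
lemma exists_log_pow_mul_le {p : ℝ} (hp : p ∈ Set.Ioo (0 : ℝ) 1) :
    ∃ a > 0, ∃ K ≥ 0, ∀ i : ℕ,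
      Real.log (p ^ i * (1 + (i : ℝ) * (1 - p))) ≤ K - a * i := by
  obtain ⟨hp0, hp1⟩ := hp
  have hL : Real.log p < 0 := Real.log_neg hp0 hp1
  have hq : 0 < 1 - p := by linarith
  set c : ℝ := -Real.log p / 2 / (1 - p) with hc_def
  have hc : 0 < c := div_pos (by linarith) hq
  have hcq : c * (1 - p) = -Real.log p / 2 := div_mul_cancel₀ _ hq.ne'
  refine ⟨-Real.log p / 2, by linarith, |c - 1 - Real.log c|, abs_nonneg _, fun i => ?_⟩
  have hx : 0 < 1 + (i : ℝ) * (1 - p) := by positivity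
  rw [Real.log_mul (pow_pos hp0 i).ne' hx.ne', Real.log_pow]
  have h := log_le_mul_sub_one_sub_log hc hx
  have hK := le_abs_self (c - 1 - Real.log c)
  have he : c * (1 + (i : ℝ) * (1 - p)) = c + i * (-Real.log p / 2) := by
    rw [← hcq]; ring
  linarith

/-- If `f i ≤ K - a * i`, the partial sums of `f i / (i * (i + 1))` are bounded by a constant
minus a multiple of the harmonic sums. -/
lemma sum_Icc_div_mul_succ_le {f : ℕ → ℝ} {a K : ℝ} (h : ∀ i, f i ≤ K - a * i) (n : ℕ) :
    ∑ i ∈ Finset.Icc 1 n, f i / ((i : ℝ) * ((i : ℝ) + 1)) ≤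
      K * (1 - 1 / ((n : ℝ) + 1)) -
        a * (∑ i ∈ Finset.range (n + 1), 1 / ((i : ℝ) + 1) - 1) := by
  induction n with
  | zero => simp
  | succ n ih =>
    rw [Finset.sum_Icc_succ_top (by omega), Finset.sum_range_succ _ (n + 1)]
    have hn : f (n + 1) / (((n + 1 : ℕ) : ℝ) * (((n + 1 : ℕ) : ℝ) + 1)) ≤
        (K - a * ((n + 1 : ℕ) : ℝ)) / (((n + 1 : ℕ) : ℝ) * (((n + 1 : ℕ) : ℝ) + 1)) := by
      gcongr
      exact h (n + 1)
    have he : (K - a * ((n + 1 : ℕ) : ℝ)) / (((n + 1 : ℕ) : ℝ) * (((n + 1 : ℕ) : ℝ) + 1)) =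
        K * (1 / ((n : ℝ) + 1) - 1 / (((n + 1 : ℕ) : ℝ) + 1)) -
          a * (1 / (((n + 1 : ℕ) : ℝ) + 1)) := by
      push_cast
      field_simp
      ring
    linarith

theorem stmt18 (p : ℝ) (hp : p ∈ Set.Ioo (0 : ℝ) 1) :
    Filter.Tendsto
      (fun n : ℕ => ∑ i ∈ Finset.Icc 1 n,
        Real.log (p ^ i * (1 + (i : ℝ) * (1 - p))) / ((i : ℝ) * ((i : ℝ) + 1)))
      Filter.atTop Filter.atBot := by
  obtain ⟨a, ha, K, hK, h⟩ := exists_log_pow_mul_le hp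
  have hharm : Filter.Tendsto
      (fun n : ℕ => a * ∑ i ∈ Finset.range (n + 1), 1 / ((i : ℝ) + 1))
      Filter.atTop Filter.atTop :=
    (Real.tendsto_sum_range_one_div_nat_succ_atTop.comp
      (Filter.tendsto_add_atTop_nat 1)).const_mul_atTop ha
  refine Filter.tendsto_atBot_mono (fun n => ?_)
    (Filter.tendsto_atBot_add_const_left _ (K + a) (Filter.tendsto_neg_atTop_atBot.comp hharm))
  have hn : 0 ≤ K * (1 / ((n : ℝ) + 1)) := by positivity
  have hs := sum_Icc_div_mul_succ_le h n
  simp only [Function.comp_apply]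
  linarith
end

section
/- Consider the function f(t₁,t₂) := t₁² + 2t₁(ln(t₂/t₁) + 1) − 3t₁t₂ on the region {(t₁,t₂) : 0 < t₁ ≤ t₂ ≤ 1}. There is a unique x₀ ∈ (0,1) satisfying x₀ − ln x₀ = 1 + ln(3/2), and f attains its maximum over the region at the point (t₁, t₂) = (x₀, 2/3); in particular sup f = f(x₀, 2/3) = x₀² + 2x₀(ln(2/(3x₀)) + 1) − 2x₀. -/
/-- On `(0, 1]` the function `x ↦ log x - x` is strictly increasing. -/
theorem log_sub_log_lt_sub {a b : ℝ} (ha : 0 < a) (hab : a < b) (hb : b ≤ 1) :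
    Real.log a - Real.log b < a - b := by
  have hb0 : 0 < b := ha.trans hab
  rw [← Real.log_div ha.ne' hb0.ne']
  have h1 : Real.log (a / b) < a / b - 1 :=
    Real.log_lt_sub_one_of_pos (div_pos ha hb0) (div_lt_one hb0 |>.2 hab).ne
  have h2 : a / b - 1 ≤ a - b := by
    rw [div_sub_one hb0.ne', div_le_iff₀ hb0]
    nlinarith
  linarith

/-- A second-order lower bound for `t * log (t / x)` on `(0, 1]`. -/
theorem sub_add_sq_le_mul_log {x t : ℝ} (hx : 0 < x) (hx1 : x ≤ 1) (ht : 0 < t) (ht1 : t ≤ 1) :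
    (t - x) ^ 2 + 2 * (t - x) ≤ 2 * t * (Real.log t - Real.log x) := by
  let φ : ℝ → ℝ := fun s ↦ 2 * s * (Real.log s - Real.log x) - (s - x) ^ 2 - 2 * (s - x)
  have hφ : ∀ s, 0 < s → HasDerivAt φ (2 * (Real.log s - Real.log x - (s - x))) s := by
    intro s hs
    have h1 := ((hasDerivAt_id s).const_mul 2).mul
      ((Real.hasDerivAt_log hs.ne').sub_const (Real.log x))
    have h2 := (h1.sub (((hasDerivAt_id s).sub_const x).pow 2)).sub
      (((hasDerivAt_id s).sub_const x).const_mul 2)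
    refine h2.congr_deriv ?_
    simp only [id]
    field_simp
    ring
  have hφx : φ x = 0 := by simp [φ]
  suffices h : 0 ≤ φ t by
    simp only [φ] at h
    linarith
  rcases lt_trichotomy x t with hxt | rfl | htx
  · obtain ⟨c, ⟨hc1, hc2⟩, hc⟩ := exists_hasDerivAt_eq_slope φ _ hxt
      (fun s hs ↦ (hφ s (hx.trans_le hs.1)).continuousAt.continuousWithinAt)
      (fun s hs ↦ hφ s (hx.trans hs.1))
    have := log_sub_log_lt_sub hx hc1 (hc2.le.trans ht1)
    rw [eq_div_iff (sub_pos.2 hxt).ne', hφx] at hc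
    nlinarith
  · exact hφx.ge
  · obtain ⟨c, ⟨hc1, hc2⟩, hc⟩ := exists_hasDerivAt_eq_slope φ _ htx
      (fun s hs ↦ (hφ s (ht.trans_le hs.1)).continuousAt.continuousWithinAt)
      (fun s hs ↦ hφ s (ht.trans hs.1))
    have := log_sub_log_lt_sub (ht.trans hc1) hc2 hx1
    rw [eq_div_iff (sub_pos.2 htx).ne', hφx] at hc
    nlinarith

/-- The equation `x - log x = 1 + log (3 / 2)` has a solution in `(0, 1)`. -/
theorem exists_sub_log_eq :
    ∃ x : ℝ, x ∈ Set.Ioo (0 : ℝ) 1 ∧ x - Real.log x = 1 + Real.log (3 / 2) := by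
  have he0 : 0 < Real.exp (-2) := Real.exp_pos _
  have he1 : Real.exp (-2) < 1 := Real.exp_lt_one_iff.2 (by norm_num)
  have hsub : Set.uIcc (Real.exp (-2)) (2 / 3) ⊆ Set.Ioo (0 : ℝ) 1 :=
    Set.ordConnected_Ioo.uIcc_subset ⟨he0, he1⟩ ⟨by norm_num, by norm_num⟩
  have hcont : ContinuousOn (fun x : ℝ ↦ x - Real.log x) (Set.uIcc (Real.exp (-2)) (2 / 3)) :=
    continuousOn_id.sub (Real.continuousOn_log.mono fun x hx ↦ (hsub hx).1.ne')
  have hlog : Real.log (3 / 2) ≤ 3 / 2 - 1 := Real.log_le_sub_one_of_pos (by norm_num)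
  have hinv : Real.log (2 / 3) = -Real.log (3 / 2) := by
    rw [← Real.log_inv]; norm_num
  obtain ⟨x, hx, hxe⟩ := intermediate_value_uIcc hcont
    (show 1 + Real.log (3 / 2) ∈ _ from Set.mem_uIcc.2 <| Or.inr
      ⟨by simp only [hinv]; linarith, by simp only [Real.log_exp]; linarith⟩)
  exact ⟨x, hsub hx, hxe⟩

theorem stmt19 :
    (∃! x₀ : ℝ, x₀ ∈ Set.Ioo (0 : ℝ) 1 ∧
      x₀ - Real.log x₀ = 1 + Real.log (3 / 2)) ∧
    (∀ x₀ : ℝ, x₀ ∈ Set.Ioo (0 : ℝ) 1 →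
      x₀ - Real.log x₀ = 1 + Real.log (3 / 2) →
      x₀ ≤ 2 / 3 ∧
      (∀ t₁ t₂ : ℝ, 0 < t₁ → t₁ ≤ t₂ → t₂ ≤ 1 →
        t₁ ^ 2 + 2 * t₁ * (Real.log (t₂ / t₁) + 1) - 3 * t₁ * t₂ ≤
          x₀ ^ 2 + 2 * x₀ * (Real.log ((2 / 3) / x₀) + 1) - 3 * x₀ * (2 / 3)) ∧
      x₀ ^ 2 + 2 * x₀ * (Real.log ((2 / 3) / x₀) + 1) - 3 * x₀ * (2 / 3) =
        x₀ ^ 2 + 2 * x₀ * (Real.log (2 / (3 * x₀)) + 1) - 2 * x₀) := by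
  have hinv : Real.log (2 / 3) = -Real.log (3 / 2) := by
    rw [← Real.log_inv]; norm_num
  refine ⟨?_, ?_⟩
  · obtain ⟨x, hx, hxe⟩ := exists_sub_log_eq
    refine ⟨x, ⟨hx, hxe⟩, ?_⟩
    rintro y ⟨hy, hye⟩
    rcases lt_trichotomy y x with h | h | h
    · linarith [log_sub_log_lt_sub hy.1 h hx.2.le]
    · exact h
    · linarith [log_sub_log_lt_sub hx.1 h hy.2.le]
  · rintro x ⟨hx0, hx1⟩ hx
    refine ⟨?_, ?_, ?_⟩
    · by_contra! h
      linarith [log_sub_log_lt_sub (by norm_num) h hx1.le]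
    · intro t s ht hts hs
      have hs0 : 0 < s := ht.trans_le hts
      have key := sub_add_sq_le_mul_log hx0 hx1.le ht (hts.trans hs)
      have hlog : Real.log s + Real.log (3 / 2) ≤ s * (3 / 2) - 1 := by
        rw [← Real.log_mul hs0.ne' (by norm_num)]
        exact Real.log_le_sub_one_of_pos (by positivity)
      have hmul := mul_le_mul_of_nonneg_left hlog ht.le
      rw [Real.log_div hs0.ne' ht.ne', Real.log_div (by norm_num) hx0.ne', hinv,
        show Real.log x = x - 1 - Real.log (3 / 2) by linarith]
      rw [show Real.log x = x - 1 - Real.log (3 / 2) by linarith] at key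
      linarith
    · rw [div_div]
      ring
end
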